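/- arXiv:0810.0868 — 2 statements merged into one kernel-verified Lean document; each statement's English description precedes it below -/
import Mathlib

section
/- There exists a constant C > 0 such that for all n ≥ 8 and all T ∈ BPT(n): | ν(T) − (2n − 6 − 2c_T/(2n−5) − 6τ_T/((2n−5)(2n−7))) | ≤ C/n², where ν(T) = (1/b(n)) · ∑_{T' ∈ BPT(n)} d(T,T') is the mean Robinson–Foulds distance from T to a uniformly random tree in BPT(n). -/
open scoped Classical symmDiff

noncomputable section

/-- `b n = (2n-5)!!`, the number of fully resolved phylogenetic trees on `n` leaves. -/
def numBPT (n : ℕ) : ℕ := ∏ k ∈ Finset.Icc 3 n, (2 * k - 5)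

/-- `G`, together with the leaf-labelling `leaf`, is a fully resolved (binary)
phylogenetic tree on the leaf set `{1,…,n}`: a tree whose degree-one vertices are
exactly the (injectively) labelled leaves, all other vertices having degree three. -/
def IsBinaryPhylo {V : Type} [Fintype V] (n : ℕ) (G : SimpleGraph V) (leaf : Fin n → V) : Prop :=
  G.IsTree ∧ Function.Injective leaf ∧
    (∀ i, G.degree (leaf i) = 1) ∧
    ∀ v : V, v ∉ Set.range leaf → G.degree v = 3

/-- The split (bipartition of the leaf-label set, as an unordered pair of subsets of
`Fin n`) induced by the edge `e`: each side consists of the labels of the leaves lying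
in the corresponding component of `G` with `e` deleted. -/
def splitOfEdge {V : Type} [Fintype V] (n : ℕ) (G : SimpleGraph V) (leaf : Fin n → V)
    (e : Sym2 V) : Sym2 (Finset (Fin n)) :=
  e.map (fun u => Finset.univ.filter (fun i => (G.deleteEdges {e}).Reachable (leaf i) u))

/-- `c(T)`: the set of splits of the phylogenetic tree. -/
def splitsOf {V : Type} [Fintype V] (n : ℕ) (G : SimpleGraph V) (leaf : Fin n → V) :
    Finset (Sym2 (Finset (Fin n))) :=
  G.edgeFinset.image (splitOfEdge n G leaf)

/-- A split is trivial if one of its sides is a singleton. -/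
def IsTrivialSplit {n : ℕ} (σ : Sym2 (Finset (Fin n))) : Prop :=
  ∃ A ∈ σ, A.card = 1

/-- The collection of split systems of fully resolved phylogenetic trees on `{1,…,n}`;
since a fully resolved phylogenetic tree is determined, up to isomorphism fixing the
leaf labels, by its set of splits, this collection is in bijection with `BPT(n)`.
(Every fully resolved tree on `n` leaves has `n-2` internal vertices, hence is
isomorphic to one with vertex set `Fin n ⊕ Fin (n-2)`, leaves labelled by `Sum.inl`.) -/
def allBPTSplits (n : ℕ) : Finset (Finset (Sym2 (Finset (Fin n)))) :=
  Finset.univ.filter (fun S => ∃ G : SimpleGraph (Fin n ⊕ Fin (n - 2)),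
    IsBinaryPhylo n G Sum.inl ∧ splitsOf n G Sum.inl = S)

/-- The number of cherries of the tree: pairs of (distinct) leaves adjacent to a
common vertex. -/
def numCherries {V : Type} [Fintype V] (n : ℕ) (G : SimpleGraph V) (leaf : Fin n → V) : ℕ :=
  (Finset.univ.filter
    (fun p : Sym2 (Fin n) => ¬ p.IsDiag ∧ ∃ v : V, ∀ i ∈ p, G.Adj (leaf i) v)).card

/-- The internal edges of the tree: edges both of whose endpoints are internal
(non-leaf) vertices. -/
def internalEdgesG {V : Type} [Fintype V] (n : ℕ) (G : SimpleGraph V) (leaf : Fin n → V) :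
    Finset (Sym2 V) :=
  G.edgeFinset.filter (fun e => ∀ v ∈ e, v ∉ Set.range leaf)

/-- `N_E(T) = ∏ᵢ β(|E̊(Fᵢ)|)`, the product over all connected components `Fᵢ` of the
forest `T - E` of the number `β(m) = b(m+3)` of fully resolved trees with `m` internal
edges, where `m = |E̊(Fᵢ)|` is the number of internal edges of `T` contained in `Fᵢ`. -/
def NEdges {V : Type} [Fintype V] (n : ℕ) (G : SimpleGraph V) (leaf : Fin n → V)
    (E : Finset (Sym2 V)) : ℕ :=
  ∏ C ∈ Finset.univ.image (G.deleteEdges (E : Set (Sym2 V))).connectedComponentMk,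
    numBPT ((((internalEdgesG n G leaf) \ E).filter
      (fun e => ∀ v ∈ e, (G.deleteEdges (E : Set (Sym2 V))).connectedComponentMk v = C)).card + 3)

/-- `r_s(T) = ∑_{E ⊆ E̊(T), |E| = s} N_E(T)`. -/
def rCoeff {V : Type} [Fintype V] (n : ℕ) (G : SimpleGraph V) (leaf : Fin n → V) (s : ℕ) : ℕ :=
  ∑ E ∈ (internalEdgesG n G leaf).powerset.filter (fun E => E.card = s), NEdges n G leaf E

/-- `q_s(T)`: the number of fully resolved phylogenetic trees on `{1,…,n}` (counted up
to isomorphism fixing leaf labels, i.e. counted via their split systems) sharing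
exactly `s` nontrivial splits with `T`. -/
def qCoeff {V : Type} [Fintype V] (n : ℕ) (G : SimpleGraph V) (leaf : Fin n → V) (s : ℕ) : ℕ :=
  ((allBPTSplits n).filter (fun S =>
    ((S ∩ splitsOf n G leaf).filter (fun σ => ¬ IsTrivialSplit σ)).card = s)).card

end

open scoped Classical symmDiff

/-- binary hierarchy on `X`. -/
structure IsBH {n : ℕ} (X : Finset (Fin n)) (H : Finset (Finset (Fin n))) : Prop where
  top : X ∈ H
  sub : ∀ C ∈ H, C ⊆ X
  ne : ∀ C ∈ H, C.Nonempty
  lam : ∀ C ∈ H, ∀ D ∈ H, C ⊆ D ∨ D ⊆ C ∨ Disjoint C D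
  bin : ∀ C ∈ H, 2 ≤ C.card → ∃ A ∈ H, ∃ B ∈ H, Disjoint A B ∧ A ∪ B = C

noncomputable def BH {n : ℕ} (X : Finset (Fin n)) : Finset (Finset (Finset (Fin n))) :=
  Finset.univ.filter (IsBH X)

section
variable {n : ℕ} {X A : Finset (Fin n)} {H : Finset (Finset (Fin n))}

lemma mem_BH : H ∈ BH X ↔ IsBH X H := by simp [BH]

/-- splitting with proper subsets -/
lemma IsBH.bin' (h : IsBH X H) {C : Finset (Fin n)} (hC : C ∈ H) (h2 : 2 ≤ C.card) :
    ∃ A ∈ H, ∃ B ∈ H, Disjoint A B ∧ A ∪ B = C ∧ A ⊂ C ∧ B ⊂ C := by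
  obtain ⟨A, hA, B, hB, hd, rfl⟩ := h.bin C hC h2
  obtain ⟨a, ha⟩ := h.ne A hA
  obtain ⟨b, hb⟩ := h.ne B hB
  rw [Finset.disjoint_left] at hd
  refine ⟨A, hA, B, hB, Finset.disjoint_left.2 hd, rfl, ?_, ?_⟩
  · refine ⟨Finset.subset_union_left, fun hs => hd (hs (Finset.mem_union_right _ hb)) hb⟩
  · refine ⟨Finset.subset_union_right, fun hs => hd ha (hs (Finset.mem_union_left _ ha))⟩

lemma IsBH.below (h : IsBH X H) {A B D : Finset (Fin n)} (hA : A ∈ H) (hB : B ∈ H)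
    (hd : Disjoint A B) (hD : D ∈ H) (hs : D ⊂ A ∪ B) : D ⊆ A ∨ D ⊆ B := by
  have h1 := h.lam D hD A hA
  have h2 := h.lam D hD B hB
  obtain ⟨d, hdd⟩ := h.ne D hD
  obtain ⟨a, haa⟩ := h.ne A hA
  obtain ⟨b, hbb⟩ := h.ne B hB
  rw [Finset.disjoint_left] at *
  rcases h1 with h1 | h1 | h1
  · exact Or.inl h1
  · rcases h2 with h2 | h2 | h2
    · exact Or.inr h2
    · exact absurd (Finset.union_subset h1 h2) hs.2
    · left; intro x hx
      have := hs.1 hx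
      grind
  · right; intro x hx
    have := hs.1 hx
    grind

lemma IsBH.single (h : IsBH X H) {x : Fin n} (hx : x ∈ X) : {x} ∈ H := by
  have key : ∀ k : ℕ, ∀ C ∈ H, C.card = k → x ∈ C → {x} ∈ H := by
    intro k
    induction k using Nat.strong_induction_on with
    | _ k ih =>
      intro C hC hk hxC
      by_cases h2 : 2 ≤ C.card
      · obtain ⟨A, hA, B, hB, hd, hU, hAC, hBC⟩ := h.bin' hC h2
        rw [← hU, Finset.mem_union] at hxC
        rcases hxC with hx | hx
        · exact ih A.card (hk ▸ Finset.card_lt_card hAC) A hA rfl hx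
        · exact ih B.card (hk ▸ Finset.card_lt_card hBC) B hB rfl hx
      · have : C.card = 1 := by
          have := Finset.card_pos.2 ⟨x, hxC⟩
          omega
        obtain ⟨y, rfl⟩ := Finset.card_eq_one.1 this
        rw [Finset.mem_singleton] at hxC
        rwa [hxC]
  exact key _ X h.top rfl hx

lemma IsBH.restrict (h : IsBH X H) (hA : A ∈ H) : IsBH A (H.filter (· ⊆ A)) := by
  refine ⟨by simp [hA], by simp, fun C hC => h.ne C (Finset.mem_filter.1 hC).1,
    fun C hC D hD => h.lam C (Finset.mem_filter.1 hC).1 D (Finset.mem_filter.1 hD).1, ?_⟩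
  intro C hC h2
  rw [Finset.mem_filter] at hC
  obtain ⟨P, hP, Q, hQ, hd, hU⟩ := h.bin C hC.1 h2
  refine ⟨P, ?_, Q, ?_, hd, hU⟩ <;> rw [Finset.mem_filter]
  · exact ⟨hP, (hU ▸ Finset.subset_union_left).trans hC.2⟩
  · exact ⟨hQ, (hU ▸ Finset.subset_union_right).trans hC.2⟩

lemma IsBH.card_eq (h : IsBH X H) : H.card + 1 = 2 * X.card := by
  have key : ∀ k : ℕ, ∀ C ∈ H, C.card = k → (H.filter (· ⊆ C)).card + 1 = 2 * k := by
    intro k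
    induction k using Nat.strong_induction_on with
    | _ k ih =>
      intro C hC hk
      by_cases h2 : 2 ≤ C.card
      · obtain ⟨A, hA, B, hB, hd, hU, hAC, hBC⟩ := h.bin' hC h2
        have h1 := ih A.card (hk ▸ Finset.card_lt_card hAC) A hA rfl
        have h3 := ih B.card (hk ▸ Finset.card_lt_card hBC) B hB rfl
        have hc : A.card + B.card = C.card := by rw [← hU, Finset.card_union_of_disjoint hd]
        have e : H.filter (· ⊆ C) = insert C (H.filter (· ⊆ A) ∪ H.filter (· ⊆ B)) := by
          ext D
          simp only [Finset.mem_filter, Finset.mem_insert, Finset.mem_union]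
          constructor
          · rintro ⟨hD, hDC⟩
            rcases eq_or_ne D C with e | e
            · exact Or.inl e
            · have : D ⊂ A ∪ B := by rw [hU]; exact Finset.ssubset_iff_subset_ne.2 ⟨hDC, e⟩
              rcases h.below hA hB hd hD this with h | h
              · exact Or.inr (Or.inl ⟨hD, h⟩)
              · exact Or.inr (Or.inr ⟨hD, h⟩)
          · rintro (rfl | ⟨hD, h⟩ | ⟨hD, h⟩)
            · exact ⟨hC, subset_rfl⟩
            · exact ⟨hD, h.trans hAC.1⟩
            · exact ⟨hD, h.trans hBC.1⟩
        have hdis : Disjoint (H.filter (· ⊆ A)) (H.filter (· ⊆ B)) := by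
          rw [Finset.disjoint_left]
          intro D hD hD'
          rw [Finset.mem_filter] at hD hD'
          obtain ⟨d, hdd⟩ := h.ne D hD.1
          exact Finset.disjoint_left.1 hd (hD.2 hdd) (hD'.2 hdd)
        rw [e, Finset.card_insert_of_notMem, Finset.card_union_of_disjoint hdis]
        · omega
        · simp only [Finset.mem_filter, Finset.mem_union]
          rintro (⟨_, h⟩ | ⟨_, h⟩)
          · exact hAC.2 h
          · exact hBC.2 h
      · have h1 : C.card = 1 := by
          have := Finset.card_pos.2 (h.ne C hC)
          omega
        obtain ⟨y, rfl⟩ := Finset.card_eq_one.1 h1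
        have : H.filter (· ⊆ {y}) = {{y}} := by
          ext D
          simp only [Finset.mem_filter, Finset.mem_singleton, Finset.subset_singleton_iff]
          constructor
          · rintro ⟨hD, h' | h'⟩
            · exact absurd h' (h.ne D hD).ne_empty
            · exact h'
          · rintro rfl
            exact ⟨hC, Or.inr rfl⟩
        rw [this]
        simp at h1 hk ⊢
        omega
  have := key _ X h.top rfl
  rwa [Finset.filter_true_of_mem h.sub] at this

/-- expansion of the point `a` to the set `A` -/
noncomputable def expand (A : Finset (Fin n)) (a : Fin n) (D : Finset (Fin n)) : Finset (Fin n) :=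
  if a ∈ D then D ∪ A else D

noncomputable def glue (A : Finset (Fin n)) (a : Fin n)
    (p : Finset (Finset (Fin n)) × Finset (Finset (Fin n))) : Finset (Finset (Fin n)) :=
  p.1 ∪ p.2.image (expand A a)

lemma expand_inter {a : Fin n} (ha : a ∈ A) {D : Finset (Fin n)} (hD : D ⊆ insert a (X \ A)) :
    expand A a D ∩ insert a (X \ A) = D := by
  unfold expand
  ext x
  have := @hD x
  split_ifs <;> grind

lemma mem_expand {a : Fin n} {D : Finset (Fin n)} {x : Fin n} :
    x ∈ expand A a D ↔ x ∈ D ∨ (a ∈ D ∧ x ∈ A) := by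
  unfold expand; split_ifs <;> grind

lemma expand_mono {a : Fin n} {D E : Finset (Fin n)} (h : D ⊆ E) :
    expand A a D ⊆ expand A a E := by
  intro x; rw [mem_expand, mem_expand]; grind

lemma expand_disj {a : Fin n} (ha : a ∈ A) {D E : Finset (Fin n)} (hD : D ⊆ insert a (X \ A))
    (hE : E ⊆ insert a (X \ A)) (h : Disjoint D E) :
    Disjoint (expand A a D) (expand A a E) := by
  rw [Finset.disjoint_left] at *
  intro x
  rw [mem_expand, mem_expand]
  have := @hD x
  have := @hE x
  have := @h x
  have := @h a
  grind

lemma expand_sub_or_disj {a : Fin n} {D : Finset (Fin n)} (hD : D ⊆ insert a (X \ A)) :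
    A ⊆ expand A a D ∨ Disjoint A (expand A a D) := by
  by_cases h : a ∈ D
  · left; intro x hx; rw [mem_expand]; exact Or.inr ⟨h, hx⟩
  · right; rw [Finset.disjoint_left]; intro x hx; rw [mem_expand]
    have := @hD x
    grind

lemma glue_mem {a : Fin n} (hAX : A ⊆ X) (ha : a ∈ A) {H₁ H₂ : Finset (Finset (Fin n))}
    (h1 : IsBH A H₁) (h2 : IsBH (insert a (X \ A)) H₂) :
    IsBH X (glue A a (H₁, H₂)) := by
  have mg : ∀ C, C ∈ glue A a (H₁, H₂) ↔ C ∈ H₁ ∨ ∃ D ∈ H₂, expand A a D = C := by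
    intro C; simp [glue]
  refine ⟨?_, ?_, ?_, ?_, ?_⟩
  · rw [mg]; right
    refine ⟨_, h2.top, ?_⟩
    ext x; rw [mem_expand]
    have := @hAX x
    grind
  · intro C hC
    rw [mg] at hC
    rcases hC with hC | ⟨D, hD, rfl⟩
    · exact (h1.sub C hC).trans hAX
    · intro x; rw [mem_expand]
      have := @hAX x
      have := @h2.sub D hD x
      have := @hAX a
      grind
  · intro C hC
    rw [mg] at hC
    rcases hC with hC | ⟨D, hD, rfl⟩
    · exact h1.ne C hC
    · obtain ⟨d, hd⟩ := h2.ne D hD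
      exact ⟨d, mem_expand.2 (Or.inl hd)⟩
  · intro C hC D hD
    rw [mg] at hC hD
    rcases hC with hC | ⟨C, hC, rfl⟩ <;> rcases hD with hD | ⟨D, hD, rfl⟩
    · exact h1.lam C hC D hD
    · rcases expand_sub_or_disj (h2.sub D hD) with h | h
      · exact Or.inl ((h1.sub C hC).trans h)
      · exact Or.inr (Or.inr (Finset.disjoint_of_subset_left (h1.sub C hC) h))
    · rcases expand_sub_or_disj (h2.sub C hC) with h | h
      · exact Or.inr (Or.inl ((h1.sub D hD).trans h))
      · exact Or.inr (Or.inr (Finset.disjoint_of_subset_left (h1.sub D hD) h).symm)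
    · rcases h2.lam C hC D hD with h | h | h
      · exact Or.inl (expand_mono h)
      · exact Or.inr (Or.inl (expand_mono h))
      · exact Or.inr (Or.inr (expand_disj ha (h2.sub C hC) (h2.sub D hD) h))
  · intro C hC hc
    rw [mg] at hC
    have low : ∀ C ∈ H₁, 2 ≤ C.card → ∃ P ∈ glue A a (H₁, H₂), ∃ Q ∈ glue A a (H₁, H₂),
        Disjoint P Q ∧ P ∪ Q = C := by
      intro C hC hc
      obtain ⟨P, hP, Q, hQ, h⟩ := h1.bin C hC hc
      exact ⟨P, (mg P).2 (Or.inl hP), Q, (mg Q).2 (Or.inl hQ), h⟩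
    rcases hC with hC | ⟨D, hD, rfl⟩
    · exact low C hC hc
    · by_cases hD2 : 2 ≤ D.card
      · obtain ⟨P, hP, Q, hQ, hd, hU⟩ := h2.bin D hD hD2
        refine ⟨expand A a P, (mg _).2 (Or.inr ⟨P, hP, rfl⟩), expand A a Q,
          (mg _).2 (Or.inr ⟨Q, hQ, rfl⟩), expand_disj ha (h2.sub P hP) (h2.sub Q hQ) hd, ?_⟩
        ext x
        rw [Finset.mem_union, mem_expand, mem_expand, mem_expand, ← hU]
        grind
      · have : D.card = 1 := by
          have := Finset.card_pos.2 (h2.ne D hD)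
          omega
        obtain ⟨y, rfl⟩ := Finset.card_eq_one.1 this
        by_cases hay : a = y
        · subst hay
          have e : expand A a {a} = A := by
            ext x; rw [mem_expand]; grind
          rw [e] at hc ⊢
          exact low A h1.top hc
        · simp [expand, hay] at hc

lemma glue_inj {a : Fin n} (ha : a ∈ A) {H₁ H₂ K₁ K₂ : Finset (Finset (Fin n))}
    (h1 : IsBH A H₁) (h2 : IsBH (insert a (X \ A)) H₂)
    (k1 : IsBH A K₁) (k2 : IsBH (insert a (X \ A)) K₂)
    (e : glue A a (H₁, H₂) = glue A a (K₁, K₂)) : H₁ ⊆ K₁ ∧ H₂ ⊆ K₂ := by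
  have mg : ∀ C, (C ∈ H₁ ∨ ∃ D ∈ H₂, expand A a D = C) ↔ (C ∈ K₁ ∨ ∃ D ∈ K₂, expand A a D = C) := by
    intro C; have := congrArg (C ∈ ·) e; simpa [glue] using this
  constructor
  · intro C hC
    rcases (mg C).1 (Or.inl hC) with h | ⟨D, hD, rfl⟩
    · exact h
    · have hs := h1.sub _ hC
      rcases expand_sub_or_disj (k2.sub D hD) with h | h
      · rw [hs.antisymm h]; exact k1.top
      · obtain ⟨x, hx⟩ := h1.ne _ hC
        exact absurd hx (Finset.disjoint_left.1 h (hs hx))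
  · intro D hD
    rcases (mg _).1 (Or.inr ⟨D, hD, rfl⟩) with h | ⟨E, hE, h⟩
    · have hs := k1.sub _ h
      have e2 := expand_inter ha (h2.sub D hD)
      have : D = {a} := by
        obtain ⟨x, hx⟩ := h2.ne D hD
        have hh : ∀ y ∈ D, y = a := by
          intro y hy
          have := h2.sub D hD hy
          have := hs (mem_expand.2 (Or.inl hy))
          grind
        ext y; constructor
        · intro hy; simp [hh y hy]
        · intro hy; rw [Finset.mem_singleton] at hy; rw [hy, ← hh x hx]; exact hx
      rw [this]
      exact k2.single (Finset.mem_insert_self _ _)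
    · have e2 := expand_inter ha (h2.sub D hD)
      have e3 := expand_inter ha (k2.sub E hE)
      rw [← e2, ← h, e3]; exact hE

lemma IsBH.contract (h : IsBH X H) (hA : A ∈ H) {a : Fin n} (ha : a ∈ A) :
    IsBH (insert a (X \ A)) ((H.filter (fun C => A ⊆ C ∨ Disjoint A C)).image
      (· ∩ insert a (X \ A))) := by
  have hAX := h.sub A hA
  have mg : ∀ D, D ∈ ((H.filter (fun C => A ⊆ C ∨ Disjoint A C)).image
      (· ∩ insert a (X \ A))) ↔ ∃ C ∈ H, (A ⊆ C ∨ Disjoint A C) ∧ C ∩ insert a (X \ A) = D := by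
    intro D; simp only [Finset.mem_image, Finset.mem_filter, and_assoc]
  refine ⟨?_, ?_, ?_, ?_, ?_⟩
  · rw [mg]
    refine ⟨X, h.top, Or.inl hAX, ?_⟩
    rw [Finset.inter_eq_right]
    intro x; have := hAX ha; grind
  · intro D hD
    rw [mg] at hD
    obtain ⟨C, hC, _, rfl⟩ := hD
    exact Finset.inter_subset_right
  · intro D hD
    rw [mg] at hD
    obtain ⟨C, hC, h' | h', rfl⟩ := hD
    · exact ⟨a, by have := h' ha; simp [this]⟩
    · obtain ⟨c, hc⟩ := h.ne C hC
      refine ⟨c, ?_⟩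
      have := Finset.disjoint_right.1 h' hc
      have := h.sub C hC hc
      grind
  · intro D hD E hE
    rw [mg] at hD hE
    obtain ⟨C, hC, _, rfl⟩ := hD
    obtain ⟨D, hD, _, rfl⟩ := hE
    rcases h.lam C hC D hD with h | h | h
    · exact Or.inl (Finset.inter_subset_inter_right h)
    · exact Or.inr (Or.inl (Finset.inter_subset_inter_right h))
    · right; right
      exact Finset.disjoint_of_subset_left Finset.inter_subset_left
        (Finset.disjoint_of_subset_right Finset.inter_subset_left h)
  · intro D hD hc
    rw [mg] at hD
    obtain ⟨C, hC, hAC, rfl⟩ := hD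
    have hC2 : 2 ≤ C.card := hc.trans (Finset.card_le_card Finset.inter_subset_left)
    obtain ⟨P, hP, Q, hQ, hd, hU⟩ := h.bin C hC hC2
    have hPQ : (A ⊆ P ∨ Disjoint A P) ∧ (A ⊆ Q ∨ Disjoint A Q) := by
      rcases hAC with hAC | hAC
      · have hne : A ≠ C := by
          rintro rfl
          have : A ∩ insert a (X \ A) ⊆ {a} := by intro x; grind
          have := Finset.card_le_card this
          simp at this
          omega
        have hs : A ⊂ P ∪ Q := by rw [hU]; exact Finset.ssubset_iff_subset_ne.2 ⟨hAC, hne⟩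
        rcases h.below hP hQ hd hA hs with h' | h'
        · exact ⟨Or.inl h', Or.inr (Finset.disjoint_of_subset_left h' hd)⟩
        · exact ⟨Or.inr (Finset.disjoint_of_subset_left h' hd.symm), Or.inl h'⟩
      · rw [← hU, Finset.disjoint_union_right] at hAC
        exact ⟨Or.inr hAC.1, Or.inr hAC.2⟩
    refine ⟨_, (mg _).2 ⟨P, hP, hPQ.1, rfl⟩, _, (mg _).2 ⟨Q, hQ, hPQ.2, rfl⟩, ?_, ?_⟩
    · exact Finset.disjoint_of_subset_left Finset.inter_subset_left
        (Finset.disjoint_of_subset_right Finset.inter_subset_left hd)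
    · rw [← Finset.union_inter_distrib_right, hU]

lemma IsBH.glue_eq (h : IsBH X H) (hA : A ∈ H) {a : Fin n} (ha : a ∈ A) :
    glue A a (H.filter (· ⊆ A), (H.filter (fun C => A ⊆ C ∨ Disjoint A C)).image
      (· ∩ insert a (X \ A))) = H := by
  have key : ∀ C ∈ H, (A ⊆ C ∨ Disjoint A C) → expand A a (C ∩ insert a (X \ A)) = C := by
    intro C hC hd
    ext x
    rw [mem_expand]
    have := @h.sub C hC x
    rcases hd with hd | hd
    · have := @hd x
      have := @hd a
      grind
    · rw [Finset.disjoint_left] at hd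
      have := @hd x
      have := @hd a
      grind
  ext C
  simp only [glue, Finset.mem_union, Finset.mem_filter, Finset.mem_image]
  constructor
  · rintro (h | ⟨_, ⟨D, ⟨hD, hd⟩, rfl⟩, rfl⟩)
    · exact h.1
    · rw [key D hD hd]; exact hD
  · intro hC
    by_cases hs : C ⊆ A
    · exact Or.inl ⟨hC, hs⟩
    · right
      have : A ⊆ C ∨ Disjoint A C := by
        rcases h.lam A hA C hC with h | h | h
        · exact Or.inl h
        · exact absurd h hs
        · exact Or.inr h
      exact ⟨_, ⟨C, ⟨hC, this⟩, rfl⟩, key C hC this⟩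

/-- counting with an additional condition on the lower part -/
lemma card_BH_contract {a : Fin n} (hAX : A ⊆ X) (ha : a ∈ A)
    (p : Finset (Fin n) → Prop) :
    ((BH X).filter (fun H => A ∈ H ∧ ∃ C ∈ H, C ⊂ A ∧ p C)).card =
      ((BH A).filter (fun H => ∃ C ∈ H, C ⊂ A ∧ p C)).card * (BH (insert a (X \ A))).card ∧
    ((BH X).filter (fun H => A ∈ H)).card = (BH A).card * (BH (insert a (X \ A))).card := by
  have inj : Set.InjOn (glue A a) ((BH A ×ˢ BH (insert a (X \ A)) : Finset _) : Set _) := by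
    rintro ⟨H₁, H₂⟩ hH ⟨K₁, K₂⟩ hK e
    simp only [Finset.coe_product, Set.mem_prod, Finset.mem_coe, mem_BH] at hH hK
    have h1 := glue_inj ha hH.1 hH.2 hK.1 hK.2 e
    have h2 := glue_inj ha hK.1 hK.2 hH.1 hH.2 e.symm
    exact Prod.ext (h1.1.antisymm h2.1) (h1.2.antisymm h2.2)
  have low : ∀ H₁ H₂, IsBH A H₁ → IsBH (insert a (X \ A)) H₂ → ∀ C, C ⊂ A →
      (C ∈ glue A a (H₁, H₂) ↔ C ∈ H₁) := by
    intro H₁ H₂ h1 h2 C hC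
    simp only [glue, Finset.mem_union, Finset.mem_image]
    constructor
    · rintro (h | ⟨D, hD, rfl⟩)
      · exact h
      · exfalso
        rcases expand_sub_or_disj (h2.sub D hD) with h | h
        · exact hC.2 h
        · obtain ⟨d, hd⟩ := h2.ne D hD
          have : d ∈ expand A a D := mem_expand.2 (Or.inl hd)
          exact Finset.disjoint_left.1 h (hC.1 this) this
    · exact Or.inl
  constructor
  · rw [← Finset.card_product, ← Finset.card_image_of_injOn (f := glue A a)
      (inj.mono (by intro x; simp +contextual))]
    congr 1
    ext H
    simp only [Finset.mem_filter, Finset.mem_image, Finset.mem_product, mem_BH, Prod.exists]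
    constructor
    · rintro ⟨h, hA, C, hC, hCA, hp⟩
      exact ⟨_, _, ⟨⟨h.restrict hA, C, by simp [hC, hCA.1], hCA, hp⟩, h.contract hA ha⟩, h.glue_eq hA ha⟩
    · rintro ⟨H₁, H₂, ⟨⟨h1, C, hC, hCA, hp⟩, h2⟩, rfl⟩
      refine ⟨glue_mem hAX ha h1 h2, ?_, C, ?_, hCA, hp⟩
      · simp [glue, h1.top]
      · exact (low _ _ h1 h2 C hCA).2 hC
  · rw [← Finset.card_product, ← Finset.card_image_of_injOn (f := glue A a) inj]
    congr 1
    ext H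
    simp only [Finset.mem_filter, Finset.mem_image, Finset.mem_product, mem_BH, Prod.exists]
    constructor
    · rintro ⟨h, hA⟩
      exact ⟨_, _, ⟨h.restrict hA, h.contract hA ha⟩, h.glue_eq hA ha⟩
    · rintro ⟨H₁, H₂, ⟨h1, h2⟩, rfl⟩
      refine ⟨glue_mem hAX ha h1 h2, ?_⟩
      simp [glue, h1.top]

end

open scoped Classical symmDiff

lemma numBPT_succ {k : ℕ} (hk : 2 ≤ k) : numBPT (k + 1) = numBPT k * (2 * (k + 1) - 5) := by
  unfold numBPT
  rw [Finset.prod_Icc_succ_top (by omega)]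

lemma numBPT_two : numBPT 2 = 1 := by simp [numBPT]
lemma numBPT_three : numBPT 3 = 1 := by simp [numBPT]

section
variable {n : ℕ} {X A : Finset (Fin n)} {H : Finset (Finset (Fin n))}

lemma card_BH_small (h0 : X.Nonempty) (h2 : X.card ≤ 2) : (BH X).card = 1 := by
  rw [Finset.card_eq_one]
  refine ⟨X.powerset.erase ∅, ?_⟩
  have cl : ∀ C, C ∈ X.powerset.erase ∅ → C = X ∨ ∃ y ∈ X, C = {y} := by
    intro C hC
    rw [Finset.mem_erase, Finset.mem_powerset] at hC
    have h1 := Finset.card_pos.2 (Finset.nonempty_iff_ne_empty.2 hC.1)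
    by_cases hc : C.card = 1
    · obtain ⟨y, rfl⟩ := Finset.card_eq_one.1 hc
      exact Or.inr ⟨y, by simpa using hC.2, rfl⟩
    · left
      exact Finset.eq_of_subset_of_card_le hC.2 (by omega)
  ext H
  rw [mem_BH, Finset.mem_singleton]
  constructor
  · intro h
    ext C
    constructor
    · intro hC
      rw [Finset.mem_erase, Finset.mem_powerset]
      exact ⟨(h.ne C hC).ne_empty, h.sub C hC⟩
    · intro hC
      rcases cl C hC with rfl | ⟨y, hy, rfl⟩
      · exact h.top
      · exact h.single hy
  · rintro rfl
    refine ⟨by simp [h0.ne_empty], ?_, ?_, ?_, ?_⟩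
    · intro C hC; simp at hC; exact hC.2
    · intro C hC; simp at hC; exact Finset.nonempty_iff_ne_empty.2 hC.1
    · intro C hC D hD
      have hC' : C ⊆ X := by simp at hC; exact hC.2
      have hD' : D ⊆ X := by simp at hD; exact hD.2
      rcases cl C hC with rfl | ⟨y, hy, rfl⟩
      · exact Or.inr (Or.inl hD')
      · rcases cl D hD with rfl | ⟨z, hz, rfl⟩
        · exact Or.inl hC'
        · by_cases hyz : y = z
          · left; rw [hyz]
          · right; right; simpa using hyz
    · intro C hC hc
      have hC' : C ⊆ X := by simp at hC; exact hC.2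
      have := Finset.card_le_card hC'
      obtain ⟨x, y, hxy, rfl⟩ := Finset.card_eq_two.1 (show C.card = 2 by omega)
      refine ⟨{x}, ?_, {y}, ?_, by simpa using hxy, rfl⟩ <;> simp <;> apply hC' <;> simp

lemma IsBH.sibling (h : IsBH X H) {x : Fin n} (hx : x ∈ X) (h2 : 2 ≤ X.card) :
    ∃! C, C ⊆ X.erase x ∧ C.Nonempty ∧ insert x C ∈ H ∧ C ∈ H := by
  have key : ∀ k : ℕ, ∀ D ∈ H, D.card = k → 2 ≤ k → x ∈ D →
      ∃ C, C ⊆ X.erase x ∧ C.Nonempty ∧ insert x C ∈ H ∧ C ∈ H := by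
    intro k
    induction k using Nat.strong_induction_on with
    | _ k ih =>
      intro D hD hk hk2 hxD
      have main : ∀ P ∈ H, ∀ Q ∈ H, Disjoint P Q → P ∪ Q = D → P ⊂ D → x ∈ P →
         ∃ C, C ⊆ X.erase x ∧ C.Nonempty ∧ insert x C ∈ H ∧ C ∈ H := by
        intro P hP Q hQ hd hU hPD hxP
        by_cases hc : 2 ≤ P.card
        · exact ih P.card (hk ▸ Finset.card_lt_card hPD) P hP rfl hc hxP
        · have : P.card = 1 := by
            have := Finset.card_pos.2 ⟨x, hxP⟩
            omega
          obtain ⟨y, rfl⟩ := Finset.card_eq_one.1 this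
          rw [Finset.mem_singleton] at hxP
          subst hxP
          refine ⟨Q, ?_, h.ne Q hQ, ?_, hQ⟩
          · intro z hz
            rw [Finset.mem_erase]
            refine ⟨?_, h.sub Q hQ hz⟩
            rintro rfl
            simp [hz] at hd
          · rw [Finset.insert_eq, hU]; exact hD
      obtain ⟨P, hP, Q, hQ, hd, hU, hPD, hQD⟩ := h.bin' hD (hk ▸ hk2)
      have hx' := hxD
      rw [← hU, Finset.mem_union] at hx'
      rcases hx' with hx' | hx'
      · exact main P hP Q hQ hd hU hPD hx'
      · exact main Q hQ P hP hd.symm (by rw [Finset.union_comm, hU]) hQD hx'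
  obtain ⟨C, hC⟩ := key _ X h.top rfl h2 hx
  refine ⟨C, hC, ?_⟩
  have half : ∀ C C' : Finset (Fin n), (C ⊆ X.erase x ∧ C.Nonempty ∧ insert x C ∈ H ∧ C ∈ H) →
     (C' ⊆ X.erase x ∧ C'.Nonempty ∧ insert x C' ∈ H ∧ C' ∈ H) → insert x C ⊆ insert x C' → C = C' := by
    rintro C C' ⟨h1, ⟨c, hc⟩, h3, h4⟩ ⟨k1, k2, k3, k4⟩ hs
    have hxC : x ∉ C := fun hh => by have := h1 hh; simp at this
    have hxC' : x ∉ C' := fun hh => by have := k1 hh; simp at this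
    have hCC : C ⊆ C' := by
      intro y hy
      have := hs (Finset.mem_insert_of_mem hy)
      grind
    refine hCC.antisymm ?_
    rcases h.lam _ h3 _ k4 with hh | hh | hh
    · exact absurd (hh (Finset.mem_insert_self _ _)) hxC'
    · intro y hy
      have := hh hy
      grind
    · exact absurd (hCC hc) (Finset.disjoint_left.1 hh (Finset.mem_insert_of_mem hc))
  intro C' hC'
  rcases h.lam _ hC.2.2.1 _ hC'.2.2.1 with hh | hh | hh
  · exact (half C C' hC hC' hh).symm
  · exact half C' C hC' hC hh
  · exact absurd (Finset.mem_insert_self x C') (Finset.disjoint_left.1 hh (Finset.mem_insert_self x C))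

lemma card_BH : ∀ m : ℕ, ∀ X : Finset (Fin n), X.card = m → X.Nonempty →
    (BH X).card = numBPT (X.card + 1) := by
  intro m
  induction m using Nat.strong_induction_on with
  | _ m ih =>
    intro Y hm hne
    by_cases hm2 : m ≤ 2
    · rw [card_BH_small hne (by omega)]
      have : 1 ≤ Y.card := Finset.card_pos.2 hne
      have : Y.card = 1 ∨ Y.card = 2 := by omega
      rcases this with h | h <;> rw [h]
      · exact numBPT_two.symm
      · exact numBPT_three.symm
    obtain ⟨x, hx⟩ := hne
    set X := Y.erase x with hX
    have hXc : X.card = m - 1 := by rw [hX, Finset.card_erase_of_mem hx, hm]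
    have hXne : X.Nonempty := by rw [← Finset.card_pos]; omega
    set P := X.powerset.erase ∅ with hP
    have mP : ∀ C, C ∈ P ↔ C ⊆ X ∧ C.Nonempty := by
      intro C; rw [hP, Finset.mem_erase, Finset.mem_powerset, Finset.nonempty_iff_ne_empty, and_comm]
    have s1 : (BH Y).card = ∑ C ∈ P, ((BH Y).filter (fun H => insert x C ∈ H ∧ C ∈ H)).card := by
      have : ∀ H ∈ BH Y, (P.filter (fun C => insert x C ∈ H ∧ C ∈ H)).card = 1 := by
        intro H hH
        rw [mem_BH] at hH
        obtain ⟨C, hC, hu⟩ := hH.sibling hx (by omega)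
        rw [Finset.card_eq_one]
        refine ⟨C, ?_⟩
        ext D
        rw [Finset.mem_filter, mP, Finset.mem_singleton]
        constructor
        · intro hD; exact hu D ⟨hD.1.1, hD.1.2, hD.2⟩
        · rintro rfl; exact ⟨⟨hC.1, hC.2.1⟩, hC.2.2⟩
      rw [Finset.card_eq_sum_ones, ← Finset.sum_congr rfl this]
      exact Finset.sum_card_bipartiteAbove_eq_sum_card_bipartiteBelow (fun H C => insert x C ∈ H ∧ C ∈ H)
    have s2 : ∑ C ∈ P, ((BH X).filter (fun H => C ∈ H)).card = (BH X).card * (2 * (m - 1) - 1) := by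
      have : ∀ H ∈ BH X, (P.filter (fun C => C ∈ H)).card = 2 * (m - 1) - 1 := by
        intro H hH
        rw [mem_BH] at hH
        have hc := hH.card_eq
        have : P.filter (fun C => C ∈ H) = H := by
          ext C
          rw [Finset.mem_filter, mP]
          exact ⟨fun h => h.2, fun h => ⟨⟨hH.sub C h, hH.ne C h⟩, h⟩⟩
        rw [this]; omega
      rw [← smul_eq_mul, ← Finset.sum_const, ← Finset.sum_congr rfl this]
      exact (Finset.sum_card_bipartiteAbove_eq_sum_card_bipartiteBelow (fun H C => C ∈ H)).symm
    have s3 : ∀ C ∈ P, ((BH Y).filter (fun H => insert x C ∈ H ∧ C ∈ H)).card =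
        ((BH X).filter (fun H => C ∈ H)).card := by
      intro C hC
      rw [mP] at hC
      obtain ⟨hCX, c, hc⟩ := hC
      have hxC : x ∉ C := fun hh => by have := hCX hh; simp [hX] at this
      have hxc : x ≠ c := by rintro rfl; exact hxC hc
      have hCY : insert x C ⊆ Y := Finset.insert_subset hx (hCX.trans (Finset.erase_subset _ _))
      have hss : C ⊂ insert x C := Finset.ssubset_insert hxC
      have e1 := (card_BH_contract hCY (Finset.mem_insert_self x C) (fun D => D = C)).1
      have e2 := (card_BH_contract (Finset.subset_insert x C) hc (fun D => D = C)).2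
      have e3 := (card_BH_contract hCX hc (fun D => D = C)).2
      have f1 : (BH Y).filter (fun H => insert x C ∈ H ∧ ∃ D ∈ H, D ⊂ insert x C ∧ D = C) =
          (BH Y).filter (fun H => insert x C ∈ H ∧ C ∈ H) := by
        apply Finset.filter_congr
        intro H _
        constructor
        · rintro ⟨h, D, hD, _, rfl⟩; exact ⟨h, hD⟩
        · rintro ⟨h, h'⟩; exact ⟨h, C, h', hss, rfl⟩
      have f2 : (BH (insert x C)).filter (fun H => ∃ D ∈ H, D ⊂ insert x C ∧ D = C) =
          (BH (insert x C)).filter (fun H => C ∈ H) := by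
        apply Finset.filter_congr
        intro H _
        constructor
        · rintro ⟨D, hD, _, rfl⟩; exact hD
        · intro h'; exact ⟨C, h', hss, rfl⟩
      replace e1 : ((BH Y).filter (fun H => insert x C ∈ H ∧ C ∈ H)).card = ((BH (insert x C)).filter (fun H => C ∈ H)).card * (BH (insert x (Y \ insert x C))).card := by
        rw [← f1, ← f2]; convert e1
      rw [e2] at e1
      rw [e1, e3]
      have g1 : (insert c (insert x C \ C)).card = 2 := by
        have : insert c (insert x C \ C) = {c, x} := by
          ext y; grind
        rw [this, Finset.card_pair hxc.symm]
      have k0 : C.card ≤ X.card := Finset.card_le_card hCX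
      have k1 : 1 ≤ C.card := Finset.card_pos.2 ⟨c, hc⟩
      have g2 : (insert c (X \ C)).card = m - C.card := by
        rw [Finset.card_insert_of_notMem (by simp [hc]), Finset.card_sdiff_of_subset hCX]
        omega
      have g3 : (insert x (Y \ insert x C)).card = m - C.card := by
        rw [Finset.card_insert_of_notMem (by simp), Finset.card_sdiff_of_subset hCY,
          Finset.card_insert_of_notMem hxC]
        omega
      rw [card_BH_small (Finset.insert_nonempty _ _) g1.le,
        ih _ (by omega) _ g2 (Finset.insert_nonempty _ _),
        ih _ (by omega) _ g3 (Finset.insert_nonempty _ _), g2, g3, mul_one]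
    rw [s1, Finset.sum_congr rfl s3, s2, ih _ (by omega) X hXc hXne, hXc, hm]
    obtain ⟨k, rfl⟩ : ∃ k, m = k + 1 := ⟨m - 1, by omega⟩
    rw [numBPT_succ (k := k + 1) (by omega)]
    congr 1

lemma card_BH_mem (hA : A ⊆ X) (hne : A.Nonempty) :
    ((BH X).filter (fun H => A ∈ H)).card = numBPT (A.card + 1) * numBPT (X.card - A.card + 2) := by
  obtain ⟨a, ha⟩ := hne
  rw [(card_BH_contract hA ha (fun _ => True)).2, card_BH _ A rfl ⟨a, ha⟩,
    card_BH _ _ rfl (Finset.insert_nonempty _ _),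
    Finset.card_insert_of_notMem (by simp [ha]), Finset.card_sdiff_of_subset hA]
end

open scoped Classical symmDiff

section
variable {V : Type} {G : SimpleGraph V}

lemma reach_closed {S : Set V} (hS : ∀ a ∈ S, ∀ b, G.Adj a b → b ∈ S) {a b : V} (ha : a ∈ S)
    (h : G.Reachable a b) : b ∈ S := by
  obtain ⟨p⟩ := h
  induction p with
  | nil => exact ha
  | cons hadj p ih => exact ih (hS _ ha _ hadj)

/-- vertices on the `u` side of the edge `uw` -/
def RS (G : SimpleGraph V) (u w : V) : Set V := {v | (G.deleteEdges {s(u, w)}).Reachable v u}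

lemma self_mem_RS (u w : V) : u ∈ RS G u w := SimpleGraph.Reachable.refl _

lemma RS_step {u w v v' : V} (hv : v ∈ RS G u w) (ha : G.Adj v v') (hne : s(v, v') ≠ s(u, w)) :
    v' ∈ RS G u w := by
  have : (G.deleteEdges {s(u, w)}).Adj v v' := by
    rw [SimpleGraph.deleteEdges_adj]; exact ⟨ha, by simpa using hne⟩
  exact this.symm.reachable.trans hv

lemma RS_induct {u w : V} {P : V → Prop} (h0 : P u)
    (hs : ∀ v v', v ∈ RS G u w → P v → G.Adj v v' → s(v, v') ≠ s(u, w) → P v') {v : V}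
    (hv : v ∈ RS G u w) : P v := by
  have := reach_closed (G := G.deleteEdges {s(u, w)}) (S := {v | v ∈ RS G u w ∧ P v})
    (a := u) (b := v) ?_ ⟨self_mem_RS u w, h0⟩ (SimpleGraph.Reachable.symm hv)
  · exact this.2
  · rintro a ⟨ha, hPa⟩ b hab
    rw [SimpleGraph.deleteEdges_adj] at hab
    have hne : s(a, b) ≠ s(u, w) := by simpa using hab.2
    exact ⟨RS_step ha hab.1 hne, hs a b ha hPa hab.1 hne⟩

variable (hT : G.IsTree)
include hT

lemma RS_not_mem {u w : V} (h : G.Adj u w) : w ∉ RS G u w := by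
  have := (SimpleGraph.isAcyclic_iff_forall_adj_isBridge.1 hT.isAcyclic) h
  rw [SimpleGraph.isBridge_iff] at this
  exact fun hh => this (SimpleGraph.Reachable.symm hh)

lemma RS_disj {u w v : V} (h : G.Adj u w) (h1 : v ∈ RS G u w) (h2 : v ∈ RS G w u) : False := by
  refine RS_not_mem hT h ?_
  have : (G.deleteEdges {s(u, w)}).Reachable v w := by
    have h2' : (G.deleteEdges {s(w, u)}).Reachable v w := h2
    rwa [Sym2.eq_swap] at h2'
  exact this.symm.trans h1

lemma RS_cover (u w v : V) : v ∈ RS G u w ∨ v ∈ RS G w u := by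
  refine reach_closed (S := {v | v ∈ RS G u w ∨ v ∈ RS G w u}) (a := u) ?_
    (Or.inl (self_mem_RS u w)) (hT.connected u v)
  intro a ha b hab
  by_cases hne : s(a, b) = s(u, w)
  · rcases Sym2.eq_iff.1 hne with ⟨rfl, rfl⟩ | ⟨rfl, rfl⟩
    · exact Or.inr (self_mem_RS _ _)
    · exact Or.inl (self_mem_RS _ _)
  · rcases ha with ha | ha
    · exact Or.inl (RS_step ha hab hne)
    · exact Or.inr (RS_step ha hab (by rwa [Sym2.eq_swap (a := w)]))

lemma RS_compl {u w v : V} (h : G.Adj u w) : v ∈ RS G w u ↔ v ∉ RS G u w := by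
  constructor
  · exact fun h1 h2 => RS_disj hT h h2 h1
  · exact fun h1 => (RS_cover hT u w v).resolve_left h1

lemma RS_sub {x u w : V} (hx : G.Adj u x) (hxw : x ≠ w) : RS G x u ⊆ RS G u w := by
  intro v hv
  refine RS_induct (P := fun v => v ∈ RS G u w) ?_ ?_ hv
  · refine RS_step (self_mem_RS u w) hx ?_
    intro h
    rcases Sym2.eq_iff.1 h with h | h
    · exact hxw h.2
    · exact hx.ne h.2.symm
  · intro a b ha hP hab hne
    refine RS_step hP hab ?_
    intro h
    have hu := RS_not_mem hT hx.symm
    rcases Sym2.eq_iff.1 h with ⟨rfl, rfl⟩ | ⟨rfl, rfl⟩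
    · exact hu ha
    · exact hu (RS_step ha hab hne)

lemma RS_cases {u w v : V} (hv : v ∈ RS G u w) : v = u ∨ ∃ x, G.Adj u x ∧ x ≠ w ∧ v ∈ RS G x u := by
  refine RS_induct (P := fun v => v = u ∨ ∃ x, G.Adj u x ∧ x ≠ w ∧ v ∈ RS G x u) (Or.inl rfl) ?_ hv
  rintro a b ha (rfl | ⟨x, hx, hxw, hax⟩) hab hne
  · right
    refine ⟨b, hab, ?_, self_mem_RS _ _⟩
    rintro rfl; exact hne rfl
  · by_cases h : s(a, b) = s(x, u)
    · rcases Sym2.eq_iff.1 h with ⟨rfl, rfl⟩ | ⟨rfl, rfl⟩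
      · exact Or.inl rfl
      · exact absurd hax (RS_not_mem hT hx.symm)
    · exact Or.inr ⟨x, hx, hxw, RS_step hax hab h⟩

lemma RS_lam {u w x y : V} (h : ¬ (x ∈ RS G u w ∧ y ∈ RS G u w)) :
    RS G u w ⊆ RS G x y ∨ RS G u w ⊆ RS G y x := by
  have main : ∀ x y, ¬ (x ∈ RS G u w ∧ y ∈ RS G u w) → u ∈ RS G x y → RS G u w ⊆ RS G x y := by
    intro x y h hu v hv
    refine RS_induct (P := fun v => v ∈ RS G x y) hu ?_ hv
    intro a b ha hP hab hne
    refine RS_step hP hab ?_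
    intro he
    have hb := RS_step ha hab hne
    rcases Sym2.eq_iff.1 he with ⟨rfl, rfl⟩ | ⟨rfl, rfl⟩
    · exact h ⟨ha, hb⟩
    · exact h ⟨hb, ha⟩
  rcases RS_cover hT x y u with hu | hu
  · exact Or.inl (main x y h hu)
  · exact Or.inr (main y x (by rwa [and_comm]) hu)

end

section
variable {V : Type} [Fintype V] {n : ℕ} {G : SimpleGraph V} {leaf : Fin n → V}

noncomputable def side (G : SimpleGraph V) (leaf : Fin n → V) (u w : V) : Finset (Fin n) :=
  Finset.univ.filter (fun i => leaf i ∈ RS G u w)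

/-- the split with side `A` -/
noncomputable def phi (A : Finset (Fin n)) : Sym2 (Finset (Fin n)) := s(A, Aᶜ)

lemma mem_phi {A B : Finset (Fin n)} : B ∈ phi A ↔ B = A ∨ B = Aᶜ := by simp [phi]

lemma phi_compl (A : Finset (Fin n)) : phi Aᶜ = phi A := by
  simp [phi, Sym2.eq_swap]

lemma phi_eq {A B : Finset (Fin n)} : phi A = phi B ↔ A = B ∨ A = Bᶜ := by
  unfold phi
  rw [Sym2.eq_iff]
  constructor
  · rintro (h | h)
    · exact Or.inl h.1
    · exact Or.inr h.1
  · rintro (rfl | rfl)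
    · exact Or.inl ⟨rfl, rfl⟩
    · exact Or.inr ⟨rfl, compl_compl _⟩

lemma mem_side {u w : V} {i : Fin n} : i ∈ side G leaf u w ↔ leaf i ∈ RS G u w := by simp [side]

variable (hB : IsBinaryPhylo n G leaf)
include hB

lemma side_compl {u w : V} (h : G.Adj u w) : side G leaf w u = (side G leaf u w)ᶜ := by
  ext i
  rw [Finset.mem_compl, mem_side, mem_side, RS_compl hB.1 h]

lemma splitOfEdge_eq {u w : V} (h : G.Adj u w) :
    splitOfEdge n G leaf s(u, w) = phi (side G leaf u w) := by
  rw [phi, ← side_compl hB h]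
  unfold splitOfEdge
  rw [Sym2.map_mk]
  have h1 : (Finset.univ.filter fun i => (G.deleteEdges {s(u, w)}).Reachable (leaf i) u) =
      side G leaf u w := by
    ext i; rw [mem_side]; simp [RS]
  have h2 : (Finset.univ.filter fun i => (G.deleteEdges {s(u, w)}).Reachable (leaf i) w) =
      side G leaf w u := by
    ext i; rw [mem_side, RS, Sym2.eq_swap]; simp
  rw [h1, h2]

lemma leaf_nbr (i : Fin n) {w x : V} (h : G.Adj (leaf i) w) (h' : G.Adj (leaf i) x) : x = w := by
  have := hB.2.2.1 i
  rw [← SimpleGraph.card_neighborFinset_eq_degree, Finset.card_eq_one] at this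
  obtain ⟨y, hy⟩ := this
  have h1 : x ∈ G.neighborFinset (leaf i) := by simpa using h'
  have h2 : w ∈ G.neighborFinset (leaf i) := by simpa using h
  rw [hy, Finset.mem_singleton] at h1 h2
  rw [h1, h2]

lemma leaf_has_nbr (i : Fin n) : ∃ w, G.Adj (leaf i) w := by
  have := hB.2.2.1 i
  rw [← SimpleGraph.card_neighborFinset_eq_degree, Finset.card_eq_one] at this
  obtain ⟨y, hy⟩ := this
  refine ⟨y, ?_⟩
  rw [← SimpleGraph.mem_neighborFinset, hy, Finset.mem_singleton]

lemma nbrs {u w : V} (hu : u ∉ Set.range leaf) (h : G.Adj u w) :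
    ∃ x y, x ≠ y ∧ x ≠ w ∧ y ≠ w ∧ ∀ z, G.Adj u z ↔ z = w ∨ z = x ∨ z = y := by
  have h3 := hB.2.2.2 u hu
  rw [← SimpleGraph.card_neighborFinset_eq_degree] at h3
  have hw : w ∈ G.neighborFinset u := by simpa using h
  have h2 : ((G.neighborFinset u).erase w).card = 2 := by
    rw [Finset.card_erase_of_mem hw, h3]
  obtain ⟨x, y, hxy, he⟩ := Finset.card_eq_two.1 h2
  have key : ∀ z, z ∈ (G.neighborFinset u).erase w ↔ z = x ∨ z = y := by
    intro z; rw [he]; simp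
  simp only [Finset.mem_erase, SimpleGraph.mem_neighborFinset] at key
  refine ⟨x, y, hxy, ((key x).2 (Or.inl rfl)).1, ((key y).2 (Or.inr rfl)).1, ?_⟩
  intro z
  have := key z
  by_cases hz : z = w
  · simp [hz, h]
  · simp only [hz, false_or, ne_eq, not_false_eq_true, true_and] at this ⊢
    exact this

lemma side_leaf {i : Fin n} {w : V} (h : G.Adj (leaf i) w) : side G leaf (leaf i) w = {i} := by
  ext j
  rw [mem_side, Finset.mem_singleton]
  constructor
  · intro hj
    rcases RS_cases hB.1 hj with hj | ⟨x, hx, hxw, _⟩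
    · exact hB.2.1 hj
    · exact absurd (leaf_nbr hB i h hx) hxw
  · rintro rfl; exact self_mem_RS _ _

lemma side_sub {u w x : V} (hx : G.Adj u x) (hxw : x ≠ w) :
    side G leaf x u ⊆ side G leaf u w := by
  intro i
  rw [mem_side, mem_side]
  exact fun h => RS_sub hB.1 hx hxw h

lemma side_split {u w x y : V} (hu : u ∉ Set.range leaf) (hxy : x ≠ y) (hxw : x ≠ w) (hyw : y ≠ w)
    (ha : ∀ z, G.Adj u z ↔ z = w ∨ z = x ∨ z = y) :
    Disjoint (side G leaf x u) (side G leaf y u) ∧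
      side G leaf x u ∪ side G leaf y u = side G leaf u w := by
  have hx : G.Adj u x := (ha x).2 (by simp)
  have hy : G.Adj u y := (ha y).2 (by simp)
  constructor
  · rw [Finset.disjoint_left]
    intro i hi hj
    have := side_sub hB hx hxy hi
    rw [mem_side] at this hj
    exact RS_disj hB.1 hy this hj
  · apply Finset.Subset.antisymm
    · exact Finset.union_subset (side_sub hB hx hxw) (side_sub hB hy hyw)
    · intro i hi
      rw [mem_side] at hi
      rw [Finset.mem_union, mem_side, mem_side]
      rcases RS_cases hB.1 hi with h | ⟨z, hz, hzw, h⟩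
      · exact absurd ⟨i, h⟩ hu
      · rcases (ha z).1 hz with rfl | rfl | rfl
        · exact absurd rfl hzw
        · exact Or.inl h
        · exact Or.inr h

lemma side_nonempty {u w : V} (h : G.Adj u w) : (side G leaf u w).Nonempty := by
  have key : ∀ k : ℕ, ∀ u w, G.Adj u w → (RS G u w).ncard = k → (side G leaf u w).Nonempty := by
    intro k
    induction k using Nat.strong_induction_on with
    | _ k ih =>
      intro u w h hk
      by_cases hu : u ∈ Set.range leaf
      · obtain ⟨i, rfl⟩ := hu
        exact ⟨i, mem_side.2 (self_mem_RS _ _)⟩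
      · obtain ⟨x, y, hxy, hxw, hyw, ha⟩ := nbrs hB hu h
        have hx : G.Adj u x := (ha x).2 (by simp)
        have hss : RS G x u ⊂ RS G u w :=
          ⟨RS_sub hB.1 hx hxw, fun hh => RS_not_mem hB.1 hx.symm (hh (self_mem_RS u w))⟩
        exact (ih _ (hk ▸ Set.ncard_lt_ncard hss) x u hx.symm rfl).mono (side_sub hB hx hxw)
  exact key _ u w h rfl

lemma leaf_of_side_card {u w : V} (h : G.Adj u w) (hc : (side G leaf u w).card ≤ 1) :
    u ∈ Set.range leaf := by
  by_contra hu
  obtain ⟨x, y, hxy, hxw, hyw, ha⟩ := nbrs hB hu h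
  obtain ⟨hd, hU⟩ := side_split hB hu hxy hxw hyw ha
  rw [← hU, Finset.card_union_of_disjoint hd] at hc
  have h1 := Finset.card_pos.2 (side_nonempty hB ((ha x).2 (by simp)).symm)
  have h2 := Finset.card_pos.2 (side_nonempty hB ((ha y).2 (by simp)).symm)
  omega

lemma mem_splitsOf {σ : Sym2 (Finset (Fin n))} :
    σ ∈ splitsOf n G leaf ↔ ∃ u w, G.Adj u w ∧ phi (side G leaf u w) = σ := by
  unfold splitsOf
  rw [Finset.mem_image]
  constructor
  · rintro ⟨e, he, rfl⟩
    induction e with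
    | _ u w =>
      rw [SimpleGraph.mem_edgeFinset, SimpleGraph.mem_edgeSet] at he
      exact ⟨u, w, he, (splitOfEdge_eq hB he).symm⟩
  · rintro ⟨u, w, h, rfl⟩
    refine ⟨s(u, w), ?_, splitOfEdge_eq hB h⟩
    rw [SimpleGraph.mem_edgeFinset, SimpleGraph.mem_edgeSet]
    exact h

lemma phi_mem_splitsOf {A : Finset (Fin n)} :
    phi A ∈ splitsOf n G leaf ↔ ∃ u w, G.Adj u w ∧ side G leaf u w = A := by
  rw [mem_splitsOf hB]
  constructor
  · rintro ⟨u, w, h, he⟩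
    rcases phi_eq.1 he with he | he
    · exact ⟨u, w, h, he⟩
    · refine ⟨w, u, h.symm, ?_⟩
      rw [side_compl hB h, he, compl_compl]
  · rintro ⟨u, w, h, he⟩
    exact ⟨u, w, h, by rw [he]⟩

/-- the hierarchy of a tree with respect to the root label `r` -/
lemma exists_hier (r : Fin n) : ∃ H, IsBH (Finset.univ.erase r) H ∧
    splitsOf n G leaf = H.image phi := by
  refine ⟨Finset.univ.filter (fun A => r ∉ A ∧ phi A ∈ splitsOf n G leaf), ?_, ?_⟩
  · have mg : ∀ A, A ∈ Finset.univ.filter (fun A => r ∉ A ∧ phi A ∈ splitsOf n G leaf) ↔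
        r ∉ A ∧ ∃ u w, G.Adj u w ∧ side G leaf u w = A := by
      intro A
      rw [Finset.mem_filter, phi_mem_splitsOf hB]
      simp
    refine ⟨?_, ?_, ?_, ?_, ?_⟩
    · rw [mg]
      obtain ⟨w, hw⟩ := leaf_has_nbr hB r
      refine ⟨by simp, w, leaf r, hw.symm, ?_⟩
      rw [side_compl hB hw, side_leaf hB hw]
      ext; simp
    · intro C hC
      rw [mg] at hC
      intro i hi
      rw [Finset.mem_erase]
      refine ⟨?_, Finset.mem_univ _⟩
      rintro rfl; exact hC.1 hi
    · intro C hC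
      rw [mg] at hC
      obtain ⟨_, u, w, h, rfl⟩ := hC
      exact side_nonempty hB h
    · intro C hC D hD
      rw [mg] at hC hD
      obtain ⟨hrC, u, w, h, rfl⟩ := hC
      obtain ⟨hrD, x, y, h', rfl⟩ := hD
      rw [mem_side] at hrC hrD
      by_cases hxy : x ∈ RS G u w ∧ y ∈ RS G u w
      · have : ¬ (x ∈ RS G w u ∧ y ∈ RS G w u) := by
          rintro ⟨h1, _⟩; exact RS_disj hB.1 h hxy.1 h1
        rcases RS_lam hB.1 this with hs | hs
        · exact absurd (hs ((RS_compl hB.1 h).2 hrC)) hrD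
        · right; left
          intro i
          rw [mem_side, mem_side]
          intro hi
          by_contra hh
          exact RS_disj hB.1 h' hi (hs ((RS_compl hB.1 h).2 hh))
      · rcases RS_lam hB.1 hxy with hs | hs
        · left; intro i; rw [mem_side, mem_side]; exact fun hh => hs hh
        · right; right
          rw [Finset.disjoint_left]
          intro i; rw [mem_side, mem_side]
          exact fun h1 h2 => RS_disj hB.1 h' h2 (hs h1)
    · intro C hC hc
      rw [mg] at hC
      obtain ⟨hrC, u, w, h, rfl⟩ := hC
      have hu : u ∉ Set.range leaf := by
        rintro ⟨i, rfl⟩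
        rw [side_leaf hB h] at hc
        simp at hc
      obtain ⟨x, y, hxy, hxw, hyw, ha⟩ := nbrs hB hu h
      obtain ⟨hd, hU⟩ := side_split hB hu hxy hxw hyw ha
      refine ⟨side G leaf x u, ?_, side G leaf y u, ?_, hd, hU⟩
      · rw [mg]
        refine ⟨fun hh => hrC ?_, x, u, ((ha x).2 (by simp)).symm, rfl⟩
        rw [← hU]; exact Finset.mem_union_left _ hh
      · rw [mg]
        refine ⟨fun hh => hrC ?_, y, u, ((ha y).2 (by simp)).symm, rfl⟩
        rw [← hU]; exact Finset.mem_union_right _ hh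
  · ext σ
    rw [Finset.mem_image]
    constructor
    · intro hσ
      obtain ⟨u, w, h, rfl⟩ := (mem_splitsOf hB).1 hσ
      by_cases hr : r ∈ side G leaf u w
      · refine ⟨(side G leaf u w)ᶜ, ?_, phi_compl _⟩
        rw [Finset.mem_filter, phi_compl]
        simp [hr, hσ]
      · refine ⟨side G leaf u w, ?_, rfl⟩
        rw [Finset.mem_filter]
        exact ⟨Finset.mem_univ _, hr, hσ⟩
    · rintro ⟨A, hA, rfl⟩
      exact (Finset.mem_filter.1 hA).2.2

omit hB in
lemma phi_injOn {r : Fin n} {H : Finset (Finset (Fin n))} (h : ∀ C ∈ H, C ⊆ Finset.univ.erase r) :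
    Set.InjOn phi (H : Set (Finset (Fin n))) := by
  intro A hA B hB e
  rcases phi_eq.1 e with e | e
  · exact e
  · exfalso
    have h1 : r ∉ A := fun hh => by have := h A hA hh; simp at this
    have h2 : r ∉ B := fun hh => by have := h B hB hh; simp at this
    rw [e] at h1
    simp [h2] at h1

lemma card_splitsOf (hn : 1 ≤ n) : (splitsOf n G leaf).card + 3 = 2 * n := by
  obtain ⟨H, hH, he⟩ := exists_hier hB ⟨0, hn⟩
  rw [he, Finset.card_image_of_injOn (phi_injOn hH.sub)]
  have := hH.card_eq
  rw [Finset.card_erase_of_mem (Finset.mem_univ _), Finset.card_univ, Fintype.card_fin] at this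
  have : 1 ≤ H.card := Finset.card_pos.2 ⟨_, hH.top⟩
  omega

lemma card_V : Fintype.card V + 2 = 2 * n ∧ G.edgeFinset.card + 3 = 2 * n := by
  have h1 := hB.1.card_edgeFinset
  have h2 := G.sum_degrees_eq_twice_card_edges
  have h3 : ∑ v, G.degree v + 2 * n = 3 * Fintype.card V := by
    have e1 : ∀ v, G.degree v + (if v ∈ Finset.univ.image leaf then 2 else 0) = 3 := by
      intro v
      split_ifs with hv
      · rw [Finset.mem_image] at hv
        obtain ⟨i, _, rfl⟩ := hv
        have := hB.2.2.1 i
        omega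
      · have := hB.2.2.2 v (by simpa using hv)
        omega
    have e2 := Finset.sum_congr (rfl : (Finset.univ : Finset V) = Finset.univ) (fun v _ => e1 v)
    rw [Finset.sum_add_distrib, Finset.sum_ite_mem, Finset.univ_inter, Finset.sum_const,
      Finset.card_image_of_injective _ hB.2.1, Finset.sum_const] at e2
    simp at e2
    omega
  have h4 : ∑ v, G.degree v = 2 * G.edgeFinset.card := by convert h2
  have h5 : G.edgeFinset.card + 1 = Fintype.card V := by convert h1
  omega

lemma split_injOn (hn : 1 ≤ n) :
    Set.InjOn (splitOfEdge n G leaf) (G.edgeFinset : Set (Sym2 V)) := by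
  rw [← Finset.card_image_iff]
  have h1 := card_splitsOf hB hn
  have h2 := (card_V hB).2
  unfold splitsOf at h1
  omega

lemma card_tau (hn : 8 ≤ n) : ((internalEdgesG n G leaf).filter
      (fun e => ∃ A ∈ splitOfEdge n G leaf e, A.card = 3)).card =
    ((splitsOf n G leaf).filter (fun σ => ∃ A ∈ σ, A.card = 3)).card := by
  rw [← Finset.card_image_of_injOn (f := splitOfEdge n G leaf)
    ((split_injOn hB (by omega)).mono ?_)]
  · congr 1
    ext σ
    unfold splitsOf internalEdgesG
    simp only [Finset.mem_image, Finset.mem_filter]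
    constructor
    · rintro ⟨e, ⟨⟨he, _⟩, h3⟩, rfl⟩
      exact ⟨⟨e, he, rfl⟩, h3⟩
    · rintro ⟨⟨e, he, rfl⟩, h3⟩
      refine ⟨e, ⟨⟨he, ?_⟩, h3⟩, rfl⟩
      rintro v hv ⟨i, rfl⟩
      obtain ⟨w, rfl⟩ := hv
      rw [SimpleGraph.mem_edgeFinset, SimpleGraph.mem_edgeSet] at he
      obtain ⟨A, hA, hc⟩ := h3
      rw [splitOfEdge_eq hB he, side_leaf hB he, mem_phi] at hA
      rcases hA with rfl | rfl
      · simp at hc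
      · rw [Finset.card_compl] at hc
        simp at hc
        omega
  · intro e he
    rw [Finset.mem_coe, Finset.mem_filter, internalEdgesG, Finset.mem_filter] at he
    exact he.1.1

lemma card_cherries (hn : 8 ≤ n) : numCherries n G leaf =
    ((splitsOf n G leaf).filter (fun σ => ∃ A ∈ σ, A.card = 2)).card := by
  unfold numCherries
  refine Finset.card_bij (fun p _ => phi p.toFinset) ?_ ?_ ?_
  · intro p hp
    induction p with
    | _ i j =>
      simp only [Finset.mem_filter, Finset.mem_univ, true_and, Sym2.mk_isDiag_iff, Sym2.mem_iff,
        forall_eq_or_imp, forall_eq] at hp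
      obtain ⟨hij, v, hi, hj⟩ := hp
      have hne : leaf i ≠ leaf j := fun h => hij (hB.2.1 h)
      have hv : v ∉ Set.range leaf := by
        rintro ⟨k, rfl⟩
        exact hne (leaf_nbr hB k hj.symm hi.symm)
      have e : (s(i, j)).toFinset = {i, j} := by ext; simp
      rw [Finset.mem_filter, e, phi_mem_splitsOf hB]
      refine ⟨?_, {i, j}, mem_phi.2 (Or.inl rfl), Finset.card_pair hij⟩
      have third : ∃ z, z ≠ leaf i ∧ z ≠ leaf j ∧
          ∀ t, G.Adj v t ↔ t = z ∨ t = leaf i ∨ t = leaf j := by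
        obtain ⟨x, y, hxy, hxw, hyw, ha⟩ := nbrs hB hv hi.symm
        rcases (ha _).1 hj.symm with h | h | h
        · exact absurd h.symm hne
        · refine ⟨y, hyw, by rw [h]; exact hxy.symm, fun t => ?_⟩
          rw [ha t, h]; tauto
        · refine ⟨x, hxw, by rw [h]; exact hxy, fun t => ?_⟩
          rw [ha t, h]; tauto
      obtain ⟨z, hzi, hzj, ha⟩ := third
      obtain ⟨_, hU⟩ := side_split hB hv hne hzi.symm hzj.symm ha
      refine ⟨v, z, (ha z).2 (by simp), ?_⟩
      rw [← hU, side_leaf hB hi, side_leaf hB hj]; rfl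
  · intro p hp q hq e
    have card2 : ∀ p : Sym2 (Fin n), ¬ p.IsDiag → p.toFinset.card = 2 := by
      intro p hp; exact Sym2.card_toFinset_of_not_isDiag p hp
    have hp2 := card2 p (Finset.mem_filter.1 hp).2.1
    have hq2 := card2 q (Finset.mem_filter.1 hq).2.1
    rcases phi_eq.1 e with e | e
    · apply Sym2.ext
      intro x
      rw [← Sym2.mem_toFinset, e, Sym2.mem_toFinset]
    · rw [e, Finset.card_compl, hq2, Fintype.card_fin] at hp2
      omega
  · intro σ hσ
    rw [Finset.mem_filter] at hσ
    obtain ⟨hσ, A, hA, hc⟩ := hσ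
    have : phi A = σ := by
      obtain ⟨u, w, h, rfl⟩ := (mem_splitsOf hB).1 hσ
      rcases mem_phi.1 hA with rfl | rfl
      · rfl
      · exact phi_compl _
    subst this
    obtain ⟨u, w, h, rfl⟩ := (phi_mem_splitsOf hB).1 hσ
    have hu : u ∉ Set.range leaf := by
      rintro ⟨i, rfl⟩
      rw [side_leaf hB h] at hc
      simp at hc
    obtain ⟨x, y, hxy, hxw, hyw, ha⟩ := nbrs hB hu h
    obtain ⟨hd, hU⟩ := side_split hB hu hxy hxw hyw ha
    have hx : G.Adj x u := ((ha x).2 (by simp)).symm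
    have hy : G.Adj y u := ((ha y).2 (by simp)).symm
    rw [← hU, Finset.card_union_of_disjoint hd] at hc
    have h1 := Finset.card_pos.2 (side_nonempty hB hx)
    have h2 := Finset.card_pos.2 (side_nonempty hB hy)
    obtain ⟨i, rfl⟩ := leaf_of_side_card hB hx (by omega)
    obtain ⟨j, rfl⟩ := leaf_of_side_card hB hy (by omega)
    have hij : i ≠ j := fun h => hxy (by rw [h])
    refine ⟨s(i, j), ?_, ?_⟩
    · simp only [Finset.mem_filter, Finset.mem_univ, true_and, Sym2.mk_isDiag_iff, Sym2.mem_iff,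
        forall_eq_or_imp, forall_eq]
      exact ⟨hij, u, hx, hy⟩
    · have e : (s(i, j)).toFinset = {i, j} := by ext; simp
      rw [e, ← hU, side_leaf hB hx, side_leaf hB hy]; rfl

end

open scoped Classical symmDiff

section
lemma RS_map {V W : Type} {G : SimpleGraph V} {G' : SimpleGraph W} (f : V → W)
    (hf : Function.Injective f) (ha : ∀ a b, G.Adj a b → G'.Adj (f a) (f b)) {u w v : V}
    (hv : v ∈ RS G u w) : f v ∈ RS G' (f u) (f w) := by
  refine RS_induct (P := fun v => f v ∈ RS G' (f u) (f w)) (self_mem_RS _ _) ?_ hv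
  intro a b _ hP hab hne
  refine RS_step hP (ha _ _ hab) ?_
  intro h
  apply hne
  rw [Sym2.eq_iff] at h ⊢
  rcases h with h | h
  · exact Or.inl ⟨hf h.1, hf h.2⟩
  · exact Or.inr ⟨hf h.1, hf h.2⟩

lemma splitsOf_mem_all {V : Type} [Fintype V] {n : ℕ} {G : SimpleGraph V} {leaf : Fin n → V}
    (hB : IsBinaryPhylo n G leaf) : splitsOf n G leaf ∈ allBPTSplits n := by
  have hc := (card_V hB).1
  have hcc : Fintype.card (Fin (n - 2)) = Fintype.card ((Set.range leaf)ᶜ : Set V) := by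
    rw [Fintype.card_compl_set, Fintype.card_fin, Set.card_range_of_injective hB.2.1, Fintype.card_fin]
    omega
  let e2 : Fin (n - 2) ≃ ((Set.range leaf)ᶜ : Set V) := Fintype.equivOfCardEq hcc
  let e : Fin n ⊕ Fin (n - 2) ≃ V :=
    (Equiv.sumCongr (Equiv.ofInjective leaf hB.2.1) e2).trans (Equiv.Set.sumCompl (Set.range leaf))
  have he : ∀ i, e (Sum.inl i) = leaf i := by intro i; simp [e]
  let G' : SimpleGraph (Fin n ⊕ Fin (n - 2)) := G.comap e
  have hadj : ∀ a b, G'.Adj a b ↔ G.Adj (e a) (e b) := fun a b => Iff.rfl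
  let f : G' ≃g G := SimpleGraph.Iso.comap e G
  have hdeg : ∀ v, G'.degree v = G.degree (e v) := by
    intro v
    rw [← SimpleGraph.card_neighborFinset_eq_degree, ← SimpleGraph.card_neighborFinset_eq_degree]
    refine Finset.card_bij (fun a _ => e a) ?_ ?_ ?_
    · intro a ha; simpa [hadj] using ha
    · intro a _ b _ h; exact e.injective h
    · intro b hb
      refine ⟨e.symm b, ?_, by simp⟩
      simpa [hadj] using hb
  have hB' : IsBinaryPhylo n G' Sum.inl := by
    refine ⟨f.isTree_iff.2 hB.1, Sum.inl_injective, ?_, ?_⟩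
    · intro i
      have := hdeg (Sum.inl i)
      rw [he, hB.2.2.1 i] at this
      exact this
    · intro v hv
      have := hdeg v
      rw [hB.2.2.2 (e v) ?_] at this
      · exact this
      · rintro ⟨i, hi⟩
        apply hv
        refine ⟨i, ?_⟩
        apply e.injective
        rw [he, hi]
  have hside : ∀ u w, side G' Sum.inl u w = side G leaf (e u) (e w) := by
    intro u w
    ext i
    rw [mem_side, mem_side, ← he]
    constructor
    · exact fun h => RS_map e e.injective (fun a b => (hadj a b).1) h
    · intro h
      have := RS_map (G' := G') e.symm e.symm.injective
        (fun a b hab => by rw [hadj]; simpa using hab) h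
      simpa using this
  unfold allBPTSplits
  rw [Finset.mem_filter]
  refine ⟨Finset.mem_univ _, G', hB', ?_⟩
  ext σ
  rw [mem_splitsOf hB', mem_splitsOf hB]
  constructor
  · rintro ⟨u, w, h, rfl⟩
    exact ⟨e u, e w, (hadj u w).1 h, by rw [hside]⟩
  · rintro ⟨u, w, h, rfl⟩
    exact ⟨e.symm u, e.symm w, by rw [hadj]; simpa using h, by rw [hside]; simp⟩
end

section
variable {α : Type} [PartialOrder α] [OrderTop α] [Finite α]
  (hu : ∀ a b c : α, a ⋖ b → a ⋖ c → b = c)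

lemma hasse_le {a b : α} (hab : a ⋖ b) : ∀ e : α, e ≤ a → e ∈ RS (SimpleGraph.hasse α) a b := by
  intro e
  induction e using WellFoundedGT.induction with
  | _ e ih =>
    intro he
    rcases he.eq_or_lt with rfl | hlt
    · exact self_mem_RS _ _
    · obtain ⟨x, hx, hxa⟩ := exists_covBy_le_of_lt hlt
      refine RS_step (ih x hx.lt hxa) (Or.inr hx) ?_
      intro h
      rcases Sym2.eq_iff.1 h with ⟨_, h⟩ | ⟨h, _⟩
      · exact absurd (h ▸ hlt) (not_lt_of_gt hab.lt)
      · exact absurd (h ▸ hxa) (not_le_of_gt hab.lt)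

lemma hasse_not_le {a b : α} (hab : a ⋖ b) :
    ∀ e : α, ¬ e ≤ a → (⊤ : α) ∈ RS (SimpleGraph.hasse α) b a →
      e ∈ RS (SimpleGraph.hasse α) b a := by
  intro e
  induction e using WellFoundedGT.induction with
  | _ e ih =>
    intro he ht
    rcases (le_top : e ≤ ⊤).eq_or_lt with rfl | hlt
    · exact ht
    · obtain ⟨x, hx, hxa⟩ := exists_covBy_le_of_lt hlt
      refine RS_step (ih x hx.lt (fun h => he (hx.le.trans h)) ht) (Or.inr hx) ?_
      intro h
      rcases Sym2.eq_iff.1 h with ⟨_, h⟩ | ⟨h, _⟩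
      · exact he h.le
      · exact he (hx.le.trans h.le)

lemma hasse_top {a b : α} (hab : a ⋖ b) : (⊤ : α) ∈ RS (SimpleGraph.hasse α) b a := by
  have key : ∀ x : α, b ≤ x → x ∈ RS (SimpleGraph.hasse α) b a := by
    intro x
    induction x using WellFoundedLT.induction with
    | _ x ih =>
      intro hx
      rcases hx.eq_or_lt with rfl | hlt
      · exact self_mem_RS _ _
      · obtain ⟨y, hy, hyx⟩ := exists_le_covBy_of_lt hlt
        refine RS_step (ih y hyx.lt hy) (Or.inl hyx) ?_
        intro h
        rcases Sym2.eq_iff.1 h with ⟨_, h⟩ | ⟨h, _⟩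
        · exact absurd (h ▸ hlt) (not_lt_of_gt hab.lt)
        · exact absurd (h ▸ hy) (not_le_of_gt hab.lt)
  exact key _ le_top

include hu in
lemma hasse_RS {a b : α} (hab : a ⋖ b) (e : α) : e ∈ RS (SimpleGraph.hasse α) a b ↔ e ≤ a := by
  refine ⟨fun h => ?_, hasse_le hab e⟩
  refine RS_induct (P := fun e => e ≤ a) le_rfl ?_ h
  intro v v' _ hv hadj hne
  rcases hadj with hadj | hadj
  · rcases hv.eq_or_lt with rfl | hlt
    · rw [hu _ _ _ hadj hab] at hne
      exact absurd rfl hne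
    · obtain ⟨x, hx, hxa⟩ := exists_covBy_le_of_lt hlt
      rw [hu _ _ _ hadj hx]; exact hxa
  · exact hadj.le.trans hv

include hu in
lemma hasse_isTree : (SimpleGraph.hasse α).IsTree := by
  constructor
  · have key : ∀ e : α, (SimpleGraph.hasse α).Reachable e ⊤ := by
      intro e
      induction e using WellFoundedGT.induction with
      | _ e ih =>
        rcases (le_top : e ≤ ⊤).eq_or_lt with rfl | hlt
        · exact SimpleGraph.Reachable.refl _
        · obtain ⟨x, hx, hxa⟩ := exists_covBy_le_of_lt hlt
          have : (SimpleGraph.hasse α).Adj e x := Or.inl hx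
          exact this.reachable.trans (ih x hx.lt)
    haveI : Nonempty α := ⟨⊤⟩
    exact ⟨fun u v => (key u).trans (key v).symm⟩
  · rw [SimpleGraph.isAcyclic_iff_forall_adj_isBridge]
    have key : ∀ v w : α, v ⋖ w → (SimpleGraph.hasse α).IsBridge s(v, w) := by
      intro v w h
      rw [SimpleGraph.isBridge_iff]
      intro hr
      have := (hasse_RS hu h w).1 hr.symm
      exact absurd this (not_le_of_gt h.lt)
    intro v w h
    rcases h with h | h
    · exact key v w h
    · rw [Sym2.eq_swap]; exact key w v h
end

section
variable {n : ℕ} {r : Fin n} {H : Finset (Finset (Fin n))}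

lemma deg_one {V : Type} [Fintype V] {G : SimpleGraph V} {v p : V} (h : ∀ z, G.Adj v z ↔ z = p) :
    G.degree v = 1 := by
  rw [← SimpleGraph.card_neighborFinset_eq_degree, Finset.card_eq_one]
  exact ⟨p, by ext z; simp [h]⟩

lemma deg_three {V : Type} [Fintype V] {G : SimpleGraph V} {v p a b : V} (h1 : p ≠ a) (h2 : p ≠ b)
    (h3 : a ≠ b) (h : ∀ z, G.Adj v z ↔ z = p ∨ z = a ∨ z = b) :
    G.degree v = 3 := by
  rw [← SimpleGraph.card_neighborFinset_eq_degree, Finset.card_eq_three]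
  exact ⟨p, a, b, h1, h2, h3, by ext z; simp [h]⟩

lemma image_phi_mem (hH : IsBH (Finset.univ.erase r) H) : H.image phi ∈ allBPTSplits n := by
  let α := {C : Finset (Fin n) // C ∈ insert Finset.univ H}
  letI : OrderTop α := { top := ⟨Finset.univ, Finset.mem_insert_self _ _⟩
                         le_top := fun a => Finset.subset_univ a.1 }
  have htop : ((⊤ : α) : Finset (Fin n)) = Finset.univ := rfl
  have hr : ∀ C ∈ H, r ∉ C := fun C hC hh => by have := hH.sub C hC hh; simp at this
  have hmem : ∀ a : α, a ≠ ⊤ → a.1 ∈ H := by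
    intro a ha
    rcases Finset.mem_insert.1 a.2 with h | h
    · exact absurd (Subtype.ext h) ha
    · exact h
  have hnt : ∀ C (hC : C ∈ H), (⟨C, Finset.mem_insert_of_mem hC⟩ : α) ≠ ⊤ := by
    intro C hC h
    have := congrArg Subtype.val h
    simp only [htop] at this
    exact hr C hC (this ▸ Finset.mem_univ r)
  have hne : ∀ a : α, a.1.Nonempty := by
    intro a
    by_cases ha : a = ⊤
    · rw [ha, htop]; exact ⟨r, Finset.mem_univ r⟩
    · exact hH.ne _ (hmem a ha)
  have hlam : ∀ a b : α, a ≤ b ∨ b ≤ a ∨ Disjoint a.1 b.1 := by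
    intro a b
    by_cases ha : a = ⊤
    · right; left; rw [ha]; exact le_top
    · by_cases hb : b = ⊤
      · left; rw [hb]; exact le_top
      · exact hH.lam _ (hmem a ha) _ (hmem b hb)
  have hu : ∀ a b c : α, a ⋖ b → a ⋖ c → b = c := by
    intro a b c hb hc
    rcases hlam b c with h | h | h
    · rcases h.eq_or_lt with h | h
      · exact h
      · exact absurd h (hc.2 hb.lt)
    · rcases h.eq_or_lt with h | h
      · exact h.symm
      · exact absurd h (hb.2 hc.lt)
    · obtain ⟨x, hx⟩ := hne a
      exact absurd (hc.le hx) (Finset.disjoint_left.1 h (hb.le hx))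
  have hpar : ∀ a : α, a ≠ ⊤ → ∃ b, a ⋖ b := by
    intro a ha
    obtain ⟨x, hx, _⟩ := exists_covBy_le_of_lt (lt_top_iff_ne_top.2 ha)
    exact ⟨x, hx⟩
  have hsing : ∀ i, i ≠ r → {i} ∈ H := fun i hi => hH.single (by simp [hi])
  let leaf : Fin n → α := fun i => if h : i = r then ⊤ else
    ⟨{i}, Finset.mem_insert_of_mem (hsing i h)⟩
  have leaf_r : leaf r = ⊤ := by simp [leaf]
  have leaf_ne : ∀ i, i ≠ r → (leaf i).1 = {i} := by intro i hi; simp [leaf, hi]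
  have leaf_nt : ∀ i, i ≠ r → leaf i ≠ ⊤ := by
    intro i hi h
    have := congrArg Subtype.val h
    rw [leaf_ne i hi, htop] at this
    have h2 := Finset.mem_univ r
    rw [← this, Finset.mem_singleton] at h2
    exact hi h2.symm
  have leaf_le : ∀ i (a : α), a ≠ ⊤ → (leaf i ≤ a ↔ i ∈ a.1) := by
    intro i a ha
    by_cases hi : i = r
    · rw [hi, leaf_r, top_le_iff]
      exact ⟨fun h => absurd h ha, fun h => absurd h (hr _ (hmem a ha))⟩
    · rw [← Subtype.coe_le_coe, leaf_ne i hi]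
      simp
  let G := SimpleGraph.hasse α
  let X : α := ⟨Finset.univ.erase r, Finset.mem_insert_of_mem hH.top⟩
  have hX : ∀ a : α, a ≠ ⊤ → a ≤ X := fun a ha => hH.sub _ (hmem a ha)
  have hXt : X ⋖ ⊤ := by
    refine ⟨lt_top_iff_ne_top.2 (hnt _ hH.top), ?_⟩
    intro c h1 h2
    exact absurd (hX c h2.ne) (not_le_of_gt h1)
  have hB : IsBinaryPhylo n G leaf := by
    refine ⟨hasse_isTree hu, ?_, ?_, ?_⟩
    · intro i j hij
      by_cases hi : i = r
      · by_cases hj : j = r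
        · rw [hi, hj]
        · rw [hi, leaf_r] at hij
          exact absurd hij.symm (leaf_nt j hj)
      · by_cases hj : j = r
        · rw [hj, leaf_r] at hij
          exact absurd hij (leaf_nt i hi)
        · have := congrArg Subtype.val hij
          rw [leaf_ne i hi, leaf_ne j hj] at this
          simpa using this
    · intro i
      by_cases hi : i = r
      · rw [hi, leaf_r]
        refine deg_one (p := X) ?_
        intro z
        constructor
        · rintro (h | h)
          · exact absurd h.lt not_top_lt
          · rcases (hX z h.lt.ne).eq_or_lt with h' | h'
            · exact h'
            · exact absurd hXt.lt (h.2 h')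
        · rintro rfl; exact Or.inr hXt
      · obtain ⟨p, hp⟩ := hpar _ (leaf_nt i hi)
        refine deg_one (p := p) ?_
        intro z
        constructor
        · rintro (h | h)
          · exact hu _ _ _ h hp
          · exfalso
            have h1 : z.1 ⊂ (leaf i).1 := h.lt
            rw [leaf_ne i hi, Finset.ssubset_singleton_iff] at h1
            exact (hne z).ne_empty h1
        · rintro rfl; exact Or.inl hp
    · intro v hv
      have hvt : v ≠ ⊤ := by rintro rfl; exact hv ⟨r, leaf_r⟩
      have hvH := hmem v hvt
      have h2 : 2 ≤ v.1.card := by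
        by_contra hlt
        have h1 : v.1.card = 1 := by
          have := Finset.card_pos.2 (hne v)
          omega
        obtain ⟨i, hi⟩ := Finset.card_eq_one.1 h1
        have hir : i ≠ r := by
          rintro rfl
          exact hr _ hvH (by rw [hi]; simp)
        exact hv ⟨i, Subtype.ext (by rw [leaf_ne i hir, hi])⟩
      obtain ⟨A, hA, B, hBB, hd, hU, hAv, hBv⟩ := hH.bin' hvH h2
      obtain ⟨p, hp⟩ := hpar v hvt
      let a : α := ⟨A, Finset.mem_insert_of_mem hA⟩
      let b : α := ⟨B, Finset.mem_insert_of_mem hBB⟩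
      have hav : a < v := hAv
      have hbv : b < v := hBv
      have hdn : ∀ z : α, z < v → z ≤ a ∨ z ≤ b := by
        intro z hz
        have hz' : z.1 ⊂ A ∪ B := by rw [hU]; exact hz
        exact hH.below hA hBB hd (hmem z (hz.trans_le le_top).ne) hz'
      have hab : ¬ a ≤ b := by
        intro h
        obtain ⟨x, hx⟩ := hne a
        exact Finset.disjoint_left.1 hd hx (h hx)
      have hba : ¬ b ≤ a := by
        intro h
        obtain ⟨x, hx⟩ := hne b
        exact Finset.disjoint_left.1 hd (h hx) hx
      have ca : a ⋖ v := by
        refine ⟨hav, ?_⟩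
        intro c h1 h2
        rcases hdn c h2 with h | h
        · exact absurd h (not_le_of_gt h1)
        · exact hab (h1.le.trans h)
      have cb : b ⋖ v := by
        refine ⟨hbv, ?_⟩
        intro c h1 h2
        rcases hdn c h2 with h | h
        · exact hba (h1.le.trans h)
        · exact absurd h (not_le_of_gt h1)
      refine deg_three (p := p) (a := a) (b := b) (hav.trans hp.lt).ne' (hbv.trans hp.lt).ne'
        (fun h => hab h.le) ?_
      intro z
      constructor
      · rintro (h | h)
        · exact Or.inl (hu _ _ _ h hp)
        · right
          rcases hdn z h.lt with h' | h'
          · left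
            rcases h'.eq_or_lt with h' | h'
            · exact h'
            · exact absurd hav (h.2 h')
          · right
            rcases h'.eq_or_lt with h' | h'
            · exact h'
            · exact absurd hbv (h.2 h')
      · rintro (rfl | rfl | rfl)
        · exact Or.inl hp
        · exact Or.inr ca
        · exact Or.inr cb
  have hside : ∀ u w : α, u ⋖ w → side G leaf u w = u.1 := by
    intro u w h
    ext i
    rw [mem_side, hasse_RS hu h, leaf_le i u (h.lt.trans_le le_top).ne]
  have heq : splitsOf n G leaf = H.image phi := by
    ext σ
    rw [mem_splitsOf hB, Finset.mem_image]
    constructor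
    · rintro ⟨u, w, h, rfl⟩
      have h' := h
      rcases h with h | h
      · exact ⟨u.1, hmem u (h.lt.trans_le le_top).ne, by rw [hside u w h]⟩
      · refine ⟨w.1, hmem w (h.lt.trans_le le_top).ne, ?_⟩
        rw [side_compl hB h'.symm, phi_compl, hside w u h]
    · rintro ⟨C, hC, rfl⟩
      obtain ⟨p, hp⟩ := hpar _ (hnt C hC)
      exact ⟨_, p, Or.inl hp, by rw [hside _ _ hp]⟩
  rw [← heq]
  exact splitsOf_mem_all hB

lemma allBPTSplits_eq (r : Fin n) :
    allBPTSplits n = (BH (Finset.univ.erase r)).image (fun H => H.image phi) := by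
  ext S
  constructor
  · intro hS
    unfold allBPTSplits at hS
    rw [Finset.mem_filter] at hS
    obtain ⟨_, G, hB, rfl⟩ := hS
    obtain ⟨H, hH, he⟩ := exists_hier hB r
    rw [Finset.mem_image]
    exact ⟨H, mem_BH.2 hH, he.symm⟩
  · rw [Finset.mem_image]
    rintro ⟨H, hH, rfl⟩
    exact image_phi_mem (mem_BH.1 hH)

lemma phi_mem_image {A : Finset (Fin n)} (hH : IsBH (Finset.univ.erase r) H) (hA : r ∉ A) :
    phi A ∈ H.image phi ↔ A ∈ H := by
  rw [Finset.mem_image]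
  constructor
  · rintro ⟨B, hB, e⟩
    have hr : r ∉ B := fun hh => by have := hH.sub B hB hh; simp at this
    rcases phi_eq.1 e with e | e
    · rwa [← e]
    · rw [e] at hr; simp [hA] at hr
  · exact fun h => ⟨A, h, rfl⟩

lemma image_phi_injOn : Set.InjOn (fun H : Finset (Finset (Fin n)) => H.image phi)
    (BH (Finset.univ.erase r) : Set (Finset (Finset (Fin n)))) := by
  intro H hH K hK e
  rw [Finset.mem_coe, mem_BH] at hH hK
  simp only at e
  ext A
  by_cases hA : r ∈ A
  · constructor
    · intro h; have := hH.sub A h hA; simp at this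
    · intro h; have := hK.sub A h hA; simp at this
  · rw [← phi_mem_image hH hA, e, phi_mem_image hK hA]

lemma card_all (hn : 2 ≤ n) : (allBPTSplits n).card = numBPT n := by
  let r : Fin n := ⟨0, by omega⟩
  rw [allBPTSplits_eq r, Finset.card_image_of_injOn image_phi_injOn]
  have hc : (Finset.univ.erase r).card = n - 1 := by
    rw [Finset.card_erase_of_mem (Finset.mem_univ _), Finset.card_univ, Fintype.card_fin]
  rw [card_BH _ _ rfl (by rw [← Finset.card_pos]; omega), hc]
  congr 1; omega

lemma card_all_mem {A : Finset (Fin n)} (h0 : A.Nonempty) (h1 : Aᶜ.Nonempty) :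
    ((allBPTSplits n).filter (fun S => phi A ∈ S)).card =
      numBPT (A.card + 1) * numBPT (n - A.card + 1) := by
  obtain ⟨r, hr⟩ := h1
  rw [Finset.mem_compl] at hr
  have e : (allBPTSplits n).filter (fun S => phi A ∈ S) =
      ((BH (Finset.univ.erase r)).filter (fun H => A ∈ H)).image (fun H => H.image phi) := by
    rw [allBPTSplits_eq r]
    ext S
    simp only [Finset.mem_filter, Finset.mem_image]
    constructor
    · rintro ⟨⟨H, hH, rfl⟩, h⟩
      rw [phi_mem_image (mem_BH.1 hH) hr] at h
      exact ⟨H, ⟨hH, h⟩, rfl⟩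
    · rintro ⟨H, ⟨hH, h⟩, rfl⟩
      exact ⟨⟨H, hH, rfl⟩, (phi_mem_image (mem_BH.1 hH) hr).2 h⟩
  have hc : (Finset.univ.erase r).card = n - 1 := by
    rw [Finset.card_erase_of_mem (Finset.mem_univ _), Finset.card_univ, Fintype.card_fin]
  have hs : A ⊆ Finset.univ.erase r := by
    intro x hx
    rw [Finset.mem_erase]
    exact ⟨by rintro rfl; exact hr hx, Finset.mem_univ _⟩
  have hle := Finset.card_le_card hs
  rw [hc] at hle
  have := Finset.card_pos.2 h0
  rw [e, Finset.card_image_of_injOn ((image_phi_injOn (r := r)).mono (by intro x; simp +contextual)),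
    card_BH_mem hs h0, hc]
  congr 2; omega
end

open scoped Classical symmDiff

lemma numBPT_pos' (k : ℕ) : 0 < numBPT k := by
  unfold numBPT
  apply Finset.prod_pos
  intro i hi
  rw [Finset.mem_Icc] at hi
  omega

lemma numBPT_conv {n : ℕ} (a : ℕ) (h4 : 4 ≤ a) (h : 2 * a ≤ n) :
    numBPT (a + 1) * numBPT (n - a + 1) ≤ numBPT 5 * numBPT (n - 3) := by
  induction a, h4 using Nat.le_induction with
  | base =>
    have : n - 4 + 1 = n - 3 := by omega
    rw [this]
  | succ a ha ih =>
    refine le_trans ?_ (ih (by omega))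
    obtain ⟨m, hm⟩ : ∃ m, n - a = m := ⟨_, rfl⟩
    have e : n - (a + 1) + 1 = m := by omega
    rw [e, hm, numBPT_succ (k := a + 1) (by omega), numBPT_succ (k := m) (by omega)]
    calc _ = numBPT (a+1) * numBPT m * (2 * (a + 1 + 1) - 5) := by ring
      _ ≤ numBPT (a+1) * numBPT m * (2 * (m + 1) - 5) := by
        apply Nat.mul_le_mul_left; omega
      _ = _ := by ring

lemma numBPT_real {k : ℕ} (hk : 3 ≤ k) :
    (numBPT k : ℝ) = numBPT (k - 1) * (2 * k - 5) := by
  obtain ⟨j, rfl⟩ : ∃ j, k = j + 1 := ⟨k - 1, by omega⟩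
  rw [numBPT_succ (by omega)]
  push_cast [Nat.cast_sub (show 5 ≤ 2 * (j + 1) by omega)]
  simp

noncomputable def low (n a : ℕ) : ℝ :=
  (if a = 1 then 1 else 0) + (if a = 2 then 1 / (2 * (n:ℝ) - 5) else 0) +
    (if a = 3 then 3 / ((2 * (n:ℝ) - 5) * (2 * (n:ℝ) - 7)) else 0)

lemma weight_bound {n a : ℕ} (hn : 8 ≤ n) (h1 : 1 ≤ a) (h : 2 * a ≤ n) :
    low n a ≤ (numBPT (a + 1) * numBPT (n - a + 1) : ℝ) / numBPT n ∧
    (numBPT (a + 1) * numBPT (n - a + 1) : ℝ) / numBPT n ≤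
      low n a + 15 / ((2 * n - 5) * (2 * n - 7) * (2 * n - 9)) := by
  have hn' : (8 : ℝ) ≤ n := by exact_mod_cast hn
  have p5 : (0:ℝ) < 2 * n - 5 := by linarith
  have p7 : (0:ℝ) < 2 * n - 7 := by linarith
  have p9 : (0:ℝ) < 2 * n - 9 := by linarith
  have b0 : (0:ℝ) < numBPT n := by exact_mod_cast numBPT_pos' n
  have b1 : (0:ℝ) < numBPT (n-1) := by exact_mod_cast numBPT_pos' _
  have b2 : (0:ℝ) < numBPT (n-2) := by exact_mod_cast numBPT_pos' _
  have b3 : (0:ℝ) < numBPT (n-3) := by exact_mod_cast numBPT_pos' _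
  have e1 := numBPT_real (k := n) (by omega)
  have e2 := numBPT_real (k := n - 1) (by omega)
  have e3 := numBPT_real (k := n - 2) (by omega)
  rw [show n - 1 - 1 = n - 2 by omega, Nat.cast_sub (by omega)] at e2
  rw [show n - 2 - 1 = n - 3 by omega, Nat.cast_sub (by omega)] at e3
  push_cast at e2 e3
  have e2' : (numBPT (n-1) : ℝ) = numBPT (n-2) * (2 * n - 7) := by rw [e2]; ring
  have e3' : (numBPT (n-2) : ℝ) = numBPT (n-3) * (2 * n - 9) := by rw [e3]; ring
  have pos : (0:ℝ) < 15 / ((2 * n - 5) * (2 * n - 7) * (2 * n - 9)) := by positivity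
  have n2 : numBPT 2 = 1 := by decide
  have n3 : numBPT 3 = 1 := by decide
  have n4 : numBPT 4 = 3 := by decide
  have n5 : numBPT 5 = 15 := by decide
  have ex : ∀ x y e : ℝ, 0 < e → x = y → y ≤ x ∧ x ≤ y + e := by
    intro x y e he h; constructor <;> linarith
  by_cases a1 : a = 1
  · subst a1
    apply ex _ _ _ pos
    rw [show n - 1 + 1 = n by omega]
    simp [low, n2, b0.ne']
  by_cases a2 : a = 2
  · subst a2
    apply ex _ _ _ pos
    rw [show n - 2 + 1 = n - 1 by omega, e1]
    simp only [low, n3]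
    norm_num
    field_simp
  by_cases a3 : a = 3
  · subst a3
    apply ex _ _ _ pos
    rw [show n - 3 + 1 = n - 2 by omega, e1, e2']
    simp only [low, n4]
    norm_num
    field_simp
  have hl : low n a = 0 := by simp [low, a1, a2, a3]
  rw [hl]
  refine ⟨by positivity, ?_⟩
  have hc := numBPT_conv a (by omega) h
  have hc' : (numBPT (a + 1) * numBPT (n - a + 1) : ℝ) ≤ 15 * numBPT (n - 3) := by
    rw [n5] at hc; exact_mod_cast hc
  calc _ ≤ 15 * (numBPT (n-3) : ℝ) / numBPT n := by gcongr
    _ = _ := by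
      rw [e1, e2', e3', zero_add]
      field_simp

section
variable {V : Type} [Fintype V] {n : ℕ} {G : SimpleGraph V} {leaf : Fin n → V}

lemma card_triv (hB : IsBinaryPhylo n G leaf) (hn : 8 ≤ n) :
    ((splitsOf n G leaf).filter (fun σ => ∃ A ∈ σ, A.card = 1)).card = n := by
  have : (splitsOf n G leaf).filter (fun σ => ∃ A ∈ σ, A.card = 1) =
      Finset.univ.image (fun i : Fin n => phi {i}) := by
    ext σ
    rw [Finset.mem_filter, Finset.mem_image, mem_splitsOf hB]
    constructor
    · rintro ⟨⟨u, w, h, rfl⟩, A, hA, hc⟩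
      obtain ⟨i, rfl⟩ := Finset.card_eq_one.1 hc
      refine ⟨i, Finset.mem_univ _, ?_⟩
      rw [phi_eq]; rwa [mem_phi] at hA
    · rintro ⟨i, -, rfl⟩
      obtain ⟨w, hw⟩ := leaf_has_nbr hB i
      refine ⟨⟨leaf i, w, hw, by rw [side_leaf hB hw]⟩, {i}, by rw [mem_phi]; simp, by simp⟩
  rw [this, Finset.card_image_of_injective, Finset.card_univ, Fintype.card_fin]
  intro i j hij
  rw [phi_eq] at hij
  rcases hij with h | h
  · simpa using h
  · have := congrArg Finset.card h
    rw [Finset.card_compl, Fintype.card_fin] at this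
    simp at this
    omega

lemma split_rep (hB : IsBinaryPhylo n G leaf) {σ} (h : σ ∈ splitsOf n G leaf) :
    ∃ A : Finset (Fin n), A.Nonempty ∧ Aᶜ.Nonempty ∧ 2 * A.card ≤ n ∧ σ = phi A := by
  obtain ⟨u, w, h', rfl⟩ := (mem_splitsOf hB).1 h
  replace h := h'
  have h1 := side_nonempty hB h
  have h2 := side_nonempty hB h.symm
  rw [side_compl hB h] at h2
  have hc := Finset.card_compl (side G leaf u w)
  rw [Fintype.card_fin] at hc
  by_cases hh : 2 * (side G leaf u w).card ≤ n
  · exact ⟨_, h1, h2, hh, rfl⟩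
  · exact ⟨_, h2, by rwa [compl_compl], by omega, (phi_compl _).symm⟩

lemma sum_sd (hB : IsBinaryPhylo n G leaf) (hn : 8 ≤ n) :
    (∑ S ∈ allBPTSplits n, ((S ∆ splitsOf n G leaf).card : ℝ)) =
      numBPT n * (4 * n - 6) - 2 * ∑ σ ∈ splitsOf n G leaf,
        (((allBPTSplits n).filter (fun S => σ ∈ S)).card : ℝ) := by
  set T := splitsOf n G leaf with hT
  have cT : T.card + 3 = 2 * n := card_splitsOf hB (by omega)
  have h1 : ∀ S ∈ allBPTSplits n, ((S ∆ T).card : ℝ) = (4 * n - 6) - 2 * ((S ∩ T).card : ℝ) := by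
    intro S hS
    have cS : S.card + 3 = 2 * n := by
      simp only [allBPTSplits, Finset.mem_filter] at hS
      obtain ⟨-, G', hG', rfl⟩ := hS
      exact card_splitsOf hG' (by omega)
    have e : (S ∆ T).card = (S \ T).card + (T \ S).card := by
      rw [symmDiff_def, Finset.sup_eq_union, Finset.card_union_of_disjoint]
      exact disjoint_sdiff_sdiff
    have e1 := Finset.card_sdiff_add_card_inter S T
    have e2 := Finset.card_sdiff_add_card_inter T S
    rw [Finset.inter_comm T S] at e2
    have : (S ∆ T).card + 2 * (S ∩ T).card + 6 = 4 * n := by omega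
    have : ((S ∆ T).card : ℝ) + 2 * (S ∩ T).card + 6 = 4 * n := by exact_mod_cast this
    linarith
  rw [Finset.sum_congr rfl h1, Finset.sum_sub_distrib, Finset.sum_const, card_all (by omega),
    nsmul_eq_mul, ← Finset.mul_sum]
  congr 2
  have := Finset.sum_card_bipartiteAbove_eq_sum_card_bipartiteBelow (s := allBPTSplits n) (t := T)
    (fun S σ => σ ∈ S)
  simp only [Finset.bipartiteAbove, Finset.bipartiteBelow] at this
  rw [← Nat.cast_sum, ← Nat.cast_sum, ← this]
  congr 1
  apply Finset.sum_congr rfl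
  intro S _
  congr 1
  ext σ
  simp [and_comm]

lemma low_eq {A : Finset (Fin n)} (hn : 8 ≤ n) (h : 2 * A.card ≤ n) :
    low n A.card = (if ∃ B ∈ phi A, B.card = 1 then 1 else 0) +
      (if ∃ B ∈ phi A, B.card = 2 then 1 / (2 * (n:ℝ) - 5) else 0) +
    (if ∃ B ∈ phi A, B.card = 3 then 3 / ((2 * (n:ℝ) - 5) * (2 * (n:ℝ) - 7)) else 0) := by
  have key : ∀ k ≤ 3, (∃ B ∈ phi A, B.card = k) ↔ A.card = k := by
    intro k hk
    constructor
    · rintro ⟨B, hB, hc⟩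
      rw [mem_phi] at hB
      rcases hB with rfl | rfl
      · exact hc
      · rw [Finset.card_compl, Fintype.card_fin] at hc; omega
    · intro h; exact ⟨A, by rw [mem_phi]; simp, h⟩
  simp only [low, key 1 (by omega), key 2 (by omega), key 3 (by omega)]

end

/-- There is a constant `C > 0` such that for all `n ≥ 8` and all
`T ∈ BPT(n)`, the mean Robinson–Foulds distance
`ν(T) = (1/b(n)) ∑_{T' ∈ BPT(n)} d(T,T')` from `T` to a uniformly random tree in
`BPT(n)` satisfies `|ν(T) - (2n - 6 - 2 c_T/(2n-5) - 6 τ_T/((2n-5)(2n-7)))| ≤ C/n²`. -/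
theorem mean_rf_distance_approx :
    ∃ C : ℝ, 0 < C ∧ ∀ n : ℕ, 8 ≤ n →
      ∀ (V : Type) (_ : Fintype V) (G : SimpleGraph V) (leaf : Fin n → V),
        IsBinaryPhylo n G leaf →
        |(∑ S ∈ allBPTSplits n, ((S ∆ splitsOf n G leaf).card : ℝ)) / (numBPT n) -
            (2 * n - 6 - 2 * (numCherries n G leaf : ℝ) / (2 * n - 5) -
              6 * (((internalEdgesG n G leaf).filter
                  (fun e => ∃ A ∈ splitOfEdge n G leaf e, A.card = 3)).card : ℝ) /
                ((2 * n - 5) * (2 * n - 7)))| ≤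
          C / (n : ℝ) ^ 2 := by
  refine ⟨120, by norm_num, ?_⟩
  intro n hn V _ G leaf hB
  have hn' : (8 : ℝ) ≤ n := by exact_mod_cast hn
  have p5 : (0:ℝ) < 2 * n - 5 := by linarith
  have p7 : (0:ℝ) < 2 * n - 7 := by linarith
  have p9 : (0:ℝ) < 2 * n - 9 := by linarith
  have b0 : (0:ℝ) < numBPT n := by exact_mod_cast numBPT_pos' n
  rw [card_tau hB hn, card_cherries hB hn, sum_sd hB hn, sub_div, mul_div_cancel_left₀ _ b0.ne',
    mul_div_assoc, Finset.sum_div]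
  have cT := card_splitsOf hB (by omega)
  have ct := card_triv hB hn
  have cT' : ((splitsOf n G leaf).card : ℝ) = 2 * n - 3 := by
    have : ((splitsOf n G leaf).card : ℝ) + 3 = 2 * n := by exact_mod_cast cT
    linarith
  set T := splitsOf n G leaf with hT
  set L : Sym2 (Finset (Fin n)) → ℝ := fun σ => (if ∃ B ∈ σ, B.card = 1 then 1 else 0) +
      (if ∃ B ∈ σ, B.card = 2 then 1 / (2 * (n:ℝ) - 5) else 0) +
    (if ∃ B ∈ σ, B.card = 3 then 3 / ((2 * (n:ℝ) - 5) * (2 * n - 7)) else 0) with hL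
  have hw : ∀ σ ∈ T, L σ ≤ (((allBPTSplits n).filter (fun S => σ ∈ S)).card : ℝ) / numBPT n ∧
      (((allBPTSplits n).filter (fun S => σ ∈ S)).card : ℝ) / numBPT n ≤
        L σ + 15 / ((2 * n - 5) * (2 * n - 7) * (2 * n - 9)) := by
    intro σ hσ
    obtain ⟨A, h1, h2, h3, rfl⟩ := split_rep hB hσ
    have := weight_bound hn (Finset.card_pos.2 h1) h3
    rw [low_eq hn h3] at this
    rw [card_all_mem h1 h2]
    push_cast
    exact this
  have s1 := Finset.sum_le_sum (fun σ hσ => (hw σ hσ).1)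
  have s2 := Finset.sum_le_sum (fun σ hσ => (hw σ hσ).2)
  rw [Finset.sum_add_distrib, Finset.sum_const, nsmul_eq_mul, cT'] at s2
  have sL : ∑ σ ∈ T, L σ = n + (T.filter (fun σ => ∃ A ∈ σ, A.card = 2)).card * (1 / (2 * (n:ℝ) - 5))
      + (T.filter (fun σ => ∃ A ∈ σ, A.card = 3)).card * (3 / ((2 * (n:ℝ) - 5) * (2 * n - 7))) := by
    rw [hL, Finset.sum_add_distrib, Finset.sum_add_distrib, ← Finset.sum_filter,
      ← Finset.sum_filter, ← Finset.sum_filter, Finset.sum_const, Finset.sum_const,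
      Finset.sum_const, ct, nsmul_eq_mul, nsmul_eq_mul, nsmul_eq_mul, mul_one]
  rw [sL] at s1 s2
  set c : ℝ := ((T.filter (fun σ => ∃ A ∈ σ, A.card = 2)).card : ℝ)
  set t : ℝ := ((T.filter (fun σ => ∃ A ∈ σ, A.card = 3)).card : ℝ)
  set X := ∑ σ ∈ T, (((allBPTSplits n).filter (fun S => σ ∈ S)).card : ℝ) / numBPT n
  have q : (2 * (n:ℝ) - 3) * (15 / ((2 * n - 5) * (2 * n - 7) * (2 * n - 9))) ≤ 60 / n ^ 2 := by
    rw [← mul_div_assoc, div_le_div_iff₀ (by positivity) (by positivity)]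
    obtain ⟨m, hm⟩ : ∃ m : ℝ, (n:ℝ) = m + 8 := ⟨n - 8, by ring⟩
    have hm0 : 0 ≤ m := by linarith
    rw [hm]
    ring_nf
    nlinarith [pow_nonneg hm0 2, pow_nonneg hm0 3]
  have f1 : 2 * c / (2 * (n:ℝ) - 5) = 2 * (c * (1 / (2 * (n:ℝ) - 5))) := by ring
  have f2 : 6 * t / ((2 * (n:ℝ) - 5) * (2 * n - 7)) =
    2 * (t * (3 / ((2 * (n:ℝ) - 5) * (2 * n - 7)))) := by ring
  have f3 : (120:ℝ) / n ^ 2 = 2 * (60 / n ^ 2) := by ring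
  rw [f1, f2, f3, abs_le]
  have : (0:ℝ) ≤ 60 / n ^ 2 := by positivity
  constructor <;> linarith
end

section
/- Let n ≥ 4 and T ∈ BPT(n). Then the number of trees T' ∈ BPT(n) with Robinson–Foulds distance d(T,T') = 2 is exactly 2(n−3); equivalently, the number of trees within distance 2 of T (including T itself) is N₂(T) = 2(n−3) + 1. -/
open scoped Classical symmDiff

namespace RF
open SimpleGraph

section graph
variable {V : Type}

def W (G : SimpleGraph V) (u v : V) : Set V :=
  {w | (G.deleteEdges {s(u,v)}).Reachable w v}

lemma reach_mem {H : SimpleGraph V} {P : Set V} (h : ∀ a b, H.Adj a b → a ∈ P → b ∈ P)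
    {a b : V} (r : H.Reachable a b) : a ∈ P → b ∈ P := by
  obtain ⟨w⟩ := r
  induction w with
  | nil => exact id
  | cons hadj _ ih => exact fun ha => ih (h _ _ hadj ha)

lemma W_self (G : SimpleGraph V) (u v : V) : v ∈ W G u v := Reachable.refl _

lemma W_adj {G : SimpleGraph V} {u v a b : V} (h : G.Adj a b) (hne : s(a,b) ≠ s(u,v)) :
    a ∈ W G u v ↔ b ∈ W G u v := by
  have h1 : (G.deleteEdges {s(u,v)}).Adj a b := by
    rw [deleteEdges_adj]; exact ⟨h, by simpa using hne⟩
  exact ⟨fun ha => (h1.symm.reachable).trans ha, fun hb => h1.reachable.trans hb⟩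

lemma W_cover {G : SimpleGraph V} (hG : G.IsTree) {u v : V} (w : V) :
    w ∈ W G u v ∨ w ∈ W G v u := by
  have := reach_mem (H := G) (P := W G u v ∪ W G v u) (a := v) (b := w) ?_
    (hG.1.preconnected v w) (Or.inl (W_self G u v))
  · exact this
  · intro a b hab ha
    by_cases hne : s(a,b) = s(u,v)
    · rw [Sym2.eq_iff] at hne
      rcases hne with ⟨_, rfl⟩ | ⟨_, rfl⟩
      · exact Or.inl (W_self _ _ _)
      · exact Or.inr (W_self _ _ _)
    · rcases ha with ha | ha
      · exact Or.inl ((W_adj hab hne).1 ha)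
      · exact Or.inr ((W_adj hab (by rwa [Sym2.eq_swap (a := v)])).1 ha)

lemma W_disj {G : SimpleGraph V} (hG : G.IsTree) {u v : V} (h : G.Adj u v) (w : V) :
    ¬ (w ∈ W G u v ∧ w ∈ W G v u) := by
  rintro ⟨h1, h2⟩
  have hb := (isAcyclic_iff_forall_adj_isBridge.1 hG.2) h
  rw [isBridge_iff] at hb
  unfold W at h1 h2
  rw [Sym2.eq_swap] at h2
  simp only [Set.mem_ofPred_eq] at h1 h2
  exact hb (h2.symm.trans h1)

lemma W_compl {G : SimpleGraph V} (hG : G.IsTree) {u v : V} (h : G.Adj u v) (w : V) :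
    w ∈ W G u v ↔ w ∉ W G v u := by
  have := W_cover hG (u := u) (v := v) w
  have := W_disj hG h w
  tauto

lemma W_char {G : SimpleGraph V} (hG : G.IsTree) {p q : V} (h : G.Adj p q) {P : Set V}
    (hq : q ∈ P) (hp : p ∉ P)
    (hP : ∀ a b, G.Adj a b → s(a,b) ≠ s(p,q) → a ∈ P → b ∈ P) (w : V) :
    w ∈ W G p q ↔ w ∈ P := by
  have key : ∀ a b, (G.deleteEdges {s(p,q)}).Reachable a b → a ∈ P → b ∈ P := by
    intro a b r
    refine reach_mem ?_ r
    intro a b hab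
    rw [deleteEdges_adj] at hab
    exact hP a b hab.1 (by simpa using hab.2)
  constructor
  · intro hw
    exact key _ _ (Reachable.symm hw) hq
  · intro hw
    rw [W_compl hG h]
    intro hw'
    unfold W at hw'
    rw [Sym2.eq_swap] at hw'
    exact hp (key _ _ hw' hw)

/-- if `x` is not on the `u`-side of edge `uv`, the `u`-side is connected off `xy`. -/
lemma W_sub {G : SimpleGraph V} {u v x y : V} (hx : x ∉ W G v u)
    (w : V) (hw : w ∈ W G v u) :
    (G.deleteEdges {s(x,y)}).Reachable w u := by
  have := reach_mem (H := G.deleteEdges {s(v,u)})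
    (P := {z | z ∈ W G v u ∧ (G.deleteEdges {s(x,y)}).Reachable z u}) (a := u) (b := w) ?_
    (Reachable.symm hw) ⟨W_self _ _ _, Reachable.refl _⟩
  · exact this.2
  · rintro a b hab ⟨h1, h2⟩
    rw [deleteEdges_adj] at hab
    have h3 := (W_adj hab.1 (by simpa using hab.2)).1 h1
    refine ⟨h3, Reachable.trans (Adj.reachable ?_) h2⟩
    rw [deleteEdges_adj]
    refine ⟨hab.1.symm, ?_⟩
    simp only [Set.mem_singleton_iff, Sym2.eq_iff]
    rintro (⟨rfl, rfl⟩ | ⟨rfl, rfl⟩) <;> contradiction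

lemma W_far {G : SimpleGraph V} (hG : G.IsTree) {v x y : V} (hx : G.Adj v x) (hy : G.Adj v y)
    (hne : x ≠ y) : y ∉ W G v x := by
  have : v ∉ W G v x := by
    rw [W_compl hG hx, not_not]; exact W_self _ _ _
  rwa [← W_adj hy (u := v) (v := x)]
  simp only [ne_eq, Sym2.eq_iff]
  rintro (⟨_, rfl⟩ | ⟨rfl, _⟩)
  · exact hne rfl
  · exact hx.ne rfl

lemma W_notself {G : SimpleGraph V} (hG : G.IsTree) {v x : V} (hx : G.Adj v x) : v ∉ W G v x := by
  rw [W_compl hG hx, not_not]; exact W_self _ _ _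

/-- distinct branches at `v` are disjoint -/
lemma W_branch_disj {G : SimpleGraph V} (hG : G.IsTree) {v x y : V} (hx : G.Adj v x)
    (hy : G.Adj v y) (hne : x ≠ y) {w : V} (hw : w ∈ W G v x) : w ∉ W G v y := by
  rw [W_compl hG hy, not_not]
  have h1 : (G.deleteEdges {s(y,v)}).Reachable w x := W_sub (W_far hG hx hy hne) w hw
  have h2 : x ∈ W G y v := by
    refine (W_adj hx.symm ?_).2 (W_self _ _ _)
    simp only [ne_eq, Sym2.eq_iff]
    rintro (⟨rfl, _⟩ | ⟨rfl, rfl⟩)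
    · exact hne rfl
    · exact hx.ne rfl
  exact h1.trans h2

lemma W_branch_exists {G : SimpleGraph V} (hG : G.IsTree) {v w : V} (hne : w ≠ v) :
    ∃ x, G.Adj v x ∧ w ∈ W G v x := by
  by_contra! hcon
  have := reach_mem (H := G) (P := {z | z = v ∨ ∃ x, G.Adj v x ∧ z ∈ W G v x}) (a := v) (b := w) ?_
    (hG.1.preconnected v w) (Or.inl rfl)
  · rcases this with h | ⟨x, h1, h2⟩
    · exact hne h
    · exact hcon x h1 h2
  · rintro a b hab (rfl | ⟨x, h1, h2⟩)
    · exact Or.inr ⟨b, hab, W_self _ _ _⟩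
    · by_cases hbv : b = v
      · exact Or.inl hbv
      · right
        refine ⟨x, h1, (W_adj hab ?_).1 h2⟩
        simp only [ne_eq, Sym2.eq_iff]
        rintro (⟨rfl, _⟩ | ⟨_, rfl⟩)
        · exact W_notself hG h1 h2
        · exact hbv rfl

lemma W_step {G : SimpleGraph V} (hG : G.IsTree) {u v : V} (h : G.Adj u v) (w : V) :
    w ∈ W G u v ↔ w = v ∨ ∃ x, x ≠ u ∧ G.Adj v x ∧ w ∈ W G v x := by
  rw [W_compl hG h]
  constructor
  · intro hw
    by_cases hwv : w = v
    · exact Or.inl hwv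
    · obtain ⟨x, h1, h2⟩ := W_branch_exists hG hwv
      refine Or.inr ⟨x, ?_, h1, h2⟩
      rintro rfl; exact hw h2
  · rintro (rfl | ⟨x, hx, h1, h2⟩)
    · exact W_notself hG h.symm
    · exact W_branch_disj hG h1 h.symm hx h2

/-- nestedness of edges -/
lemma W_nested {G : SimpleGraph V} {u v x y : V} (hx : x ∉ W G v u) (hu : u ∈ W G x y) {w : V} (hw : w ∈ W G v u) :
    w ∈ W G x y := by
  have := W_sub (y := y) hx w hw
  exact this.trans hu

end graph
section phylo
variable {V : Type} [Fintype V] {n : ℕ}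

noncomputable def L (G : SimpleGraph V) (leaf : Fin n → V) (u v : V) : Finset (Fin n) :=
  Finset.univ.filter (fun i => leaf i ∈ W G u v)

lemma mem_L {G : SimpleGraph V} {leaf : Fin n → V} {u v : V} {i : Fin n} :
    i ∈ L G leaf u v ↔ leaf i ∈ W G u v := by simp [L]

variable {G : SimpleGraph V} {leaf : Fin n → V}

lemma L_compl (hT : IsBinaryPhylo n G leaf) {u v : V} (h : G.Adj u v) :
    L G leaf v u = (L G leaf u v)ᶜ := by
  ext i
  rw [Finset.mem_compl, mem_L, mem_L, W_compl hT.1 h.symm]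

lemma split_eq (u v : V) :
    splitOfEdge n G leaf s(u,v) = s(L G leaf v u, L G leaf u v) := by
  unfold splitOfEdge
  rw [Sym2.map_mk, Sym2.eq_iff]
  left
  constructor
  · ext i
    rw [mem_L, W, Sym2.eq_swap]
    simp
  · ext i
    rw [mem_L, W]
    simp

lemma mem_splits (hT : IsBinaryPhylo n G leaf) (σ : Sym2 (Finset (Fin n))) :
    σ ∈ splitsOf n G leaf ↔
      ∃ u v, G.Adj u v ∧ σ = s(L G leaf u v, (L G leaf u v)ᶜ) := by
  unfold splitsOf
  simp only [Finset.mem_image, SimpleGraph.mem_edgeFinset]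
  constructor
  · rintro ⟨e, he, rfl⟩
    induction e with
    | _ u v =>
      refine ⟨u, v, he, ?_⟩
      rw [split_eq, L_compl hT he, Sym2.eq_swap]
  · rintro ⟨u, v, h, rfl⟩
    refine ⟨s(u,v), h, ?_⟩
    rw [split_eq, L_compl hT h, Sym2.eq_swap]

lemma cs_eq (X Y : Finset (Fin n)) : s(X, Xᶜ) = s(Y, Yᶜ) ↔ X = Y ∨ X = Yᶜ := by
  rw [Sym2.eq_iff]
  constructor
  · rintro (⟨h, _⟩ | ⟨h, _⟩)
    · exact Or.inl h
    · exact Or.inr h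
  · rintro (rfl | rfl)
    · exact Or.inl ⟨rfl, rfl⟩
    · exact Or.inr ⟨rfl, compl_compl _⟩

lemma mem_splits' (hT : IsBinaryPhylo n G leaf) (X : Finset (Fin n)) :
    s(X, Xᶜ) ∈ splitsOf n G leaf ↔ ∃ u v, G.Adj u v ∧ X = L G leaf u v := by
  rw [mem_splits hT]
  constructor
  · rintro ⟨u, v, h, h2⟩
    rcases (cs_eq _ _).1 h2 with h2 | h2
    · exact ⟨u, v, h, h2⟩
    · exact ⟨v, u, h.symm, by rw [h2, L_compl hT h]⟩
  · rintro ⟨u, v, h, rfl⟩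
    exact ⟨u, v, h, rfl⟩

lemma nbrs (hT : IsBinaryPhylo n G leaf) {u v : V} (h : G.Adj u v) (hv : v ∉ Set.range leaf) :
    ∃ x y, x ≠ u ∧ y ≠ u ∧ x ≠ y ∧ G.Adj v x ∧ G.Adj v y ∧
      ∀ z, G.Adj v z → z = u ∨ z = x ∨ z = y := by
  have h3 := hT.2.2.2 v hv
  have hu : u ∈ G.neighborFinset v := by simpa using h.symm
  have h2 : ((G.neighborFinset v).erase u).card = 2 := by
    rw [Finset.card_erase_of_mem hu, SimpleGraph.card_neighborFinset_eq_degree, h3]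
  obtain ⟨x, y, hxy, he⟩ := Finset.card_eq_two.1 h2
  have hm : ∀ z, (z ≠ u ∧ G.Adj v z) ↔ (z = x ∨ z = y) := by
    intro z
    have := congrArg (fun s => z ∈ s) he
    simpa using this
  refine ⟨x, y, ((hm x).2 (Or.inl rfl)).1, ((hm y).2 (Or.inr rfl)).1, hxy,
    ((hm x).2 (Or.inl rfl)).2, ((hm y).2 (Or.inr rfl)).2, ?_⟩
  intro z hz
  by_cases hzu : z = u
  · exact Or.inl hzu
  · exact Or.inr ((hm z).1 ⟨hzu, hz⟩)

lemma leaf_nbr (hT : IsBinaryPhylo n G leaf) {u z : V} {i : Fin n} (h : G.Adj u (leaf i))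
    (hz : G.Adj (leaf i) z) : z = u := by
  have h1 := hT.2.2.1 i
  rw [← SimpleGraph.card_neighborFinset_eq_degree] at h1
  exact Finset.card_le_one.1 h1.le z (by simpa using hz) u (by simpa using h.symm)

lemma leaf_adj (hT : IsBinaryPhylo n G leaf) (i : Fin n) : ∃ u, G.Adj u (leaf i) := by
  have h1 := hT.2.2.1 i
  rw [← SimpleGraph.card_neighborFinset_eq_degree] at h1
  obtain ⟨u, hu⟩ := Finset.card_pos.1 (by rw [h1]; exact one_pos)
  exact ⟨u, by simpa using (by simpa using hu : G.Adj (leaf i) u).symm⟩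

lemma L_leaf (hT : IsBinaryPhylo n G leaf) {u : V} {i : Fin n} (h : G.Adj u (leaf i)) :
    L G leaf u (leaf i) = {i} := by
  ext j
  rw [mem_L, W_step hT.1 h, Finset.mem_singleton]
  constructor
  · rintro (h1 | ⟨x, hx, h2, _⟩)
    · exact hT.2.1 h1
    · exact absurd (leaf_nbr hT h h2) hx
  · rintro rfl; exact Or.inl rfl

lemma L_step (hT : IsBinaryPhylo n G leaf) {u v x y : V} (h : G.Adj u v)
    (hv : v ∉ Set.range leaf) (hxu : x ≠ u) (hyu : y ≠ u) (hx : G.Adj v x) (hy : G.Adj v y)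
    (hz : ∀ z, G.Adj v z → z = u ∨ z = x ∨ z = y) :
    L G leaf u v = L G leaf v x ∪ L G leaf v y := by
  ext i
  rw [Finset.mem_union, mem_L, mem_L, mem_L, W_step hT.1 h]
  constructor
  · rintro (h1 | ⟨z, h1, h2, h3⟩)
    · exact absurd ⟨i, h1⟩ hv
    · rcases hz z h2 with rfl | rfl | rfl
      · exact absurd rfl h1
      · exact Or.inl h3
      · exact Or.inr h3
  · rintro (h1 | h1)
    · exact Or.inr ⟨x, hxu, hx, h1⟩
    · exact Or.inr ⟨y, hyu, hy, h1⟩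

lemma L_disj (hT : IsBinaryPhylo n G leaf) {v x y : V} (hx : G.Adj v x) (hy : G.Adj v y)
    (hne : x ≠ y) {i : Fin n} (h : i ∈ L G leaf v x) : i ∉ L G leaf v y := by
  rw [mem_L] at *
  exact W_branch_disj hT.1 hx hy hne h

lemma L_nonempty_aux (hT : IsBinaryPhylo n G leaf) : ∀ k : ℕ, ∀ u v : V, G.Adj u v →
    (W G u v).ncard ≤ k → (L G leaf u v).Nonempty := by
  intro k
  induction k with
  | zero =>
    intro u v h hk
    have : (W G u v).ncard = 0 := by omega
    rw [Set.ncard_eq_zero (Set.toFinite _)] at this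
    have h2 := W_self G u v
    rw [this] at h2; exact absurd h2 (Set.notMem_empty _)
  | succ k ih =>
    intro u v h hk
    by_cases hv : v ∈ Set.range leaf
    · obtain ⟨i, rfl⟩ := hv
      rw [L_leaf hT h]; exact Finset.singleton_nonempty i
    · obtain ⟨x, y, h1, h2, h3, h4, h5, h6⟩ := nbrs hT h hv
      have hs : W G v x ⊂ W G u v := by
        rw [Set.ssubset_iff_of_subset]
        · exact ⟨v, W_self _ _ _, W_notself hT.1 h4⟩
        · intro w hw
          rw [W_step hT.1 h]; exact Or.inr ⟨x, h1, h4, hw⟩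
      have := Set.ncard_lt_ncard hs (Set.toFinite _)
      rw [L_step hT h hv h1 h2 h4 h5 h6]
      exact (ih v x h4 (by omega)).mono Finset.subset_union_left

lemma L_nonempty (hT : IsBinaryPhylo n G leaf) {u v : V} (h : G.Adj u v) :
    (L G leaf u v).Nonempty := L_nonempty_aux hT _ u v h le_rfl

lemma compat (hT : IsBinaryPhylo n G leaf) {u v x y : V} (h : G.Adj u v) (h' : G.Adj x y) :
    (L G leaf u v ⊆ L G leaf x y ∨ L G leaf u v ⊆ L G leaf y x) ∨
    (L G leaf v u ⊆ L G leaf x y ∨ L G leaf v u ⊆ L G leaf y x) := by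
  have key : ∀ u v, G.Adj u v → x ∉ W G u v → y ∉ W G u v →
      (L G leaf u v ⊆ L G leaf x y ∨ L G leaf u v ⊆ L G leaf y x) := by
    intro u v h hx hy
    rcases W_cover hT.1 (u := x) (v := y) v with hv | hv
    · left; intro i hi; rw [mem_L] at *
      exact W_nested hx hv hi
    · right; intro i hi; rw [mem_L] at *
      exact W_nested hy hv hi
  by_cases he : s(x,y) = s(u,v)
  · rw [Sym2.eq_iff] at he
    rcases he with ⟨rfl, rfl⟩ | ⟨rfl, rfl⟩
    · exact Or.inl (Or.inl subset_rfl)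
    · exact Or.inl (Or.inr subset_rfl)
  · have hxy := W_adj h' he
    by_cases hx : x ∈ W G u v
    · right
      have hy := hxy.1 hx
      apply key v u h.symm
      · rwa [← W_compl hT.1 h]
      · rwa [← W_compl hT.1 h]
    · left
      exact key u v h hx (fun hy => hx (hxy.2 hy))

lemma compat_splits (hT : IsBinaryPhylo n G leaf) {X Y : Finset (Fin n)}
    (hX : s(X, Xᶜ) ∈ splitsOf n G leaf) (hY : s(Y, Yᶜ) ∈ splitsOf n G leaf) :
    (Y ⊆ X ∨ Y ⊆ Xᶜ) ∨ (Yᶜ ⊆ X ∨ Yᶜ ⊆ Xᶜ) := by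
  rw [mem_splits' hT] at hX hY
  obtain ⟨u, v, h, rfl⟩ := hX
  obtain ⟨x, y, h', rfl⟩ := hY
  rw [← L_compl hT h, ← L_compl hT h']
  exact compat hT h' h

/-- nested sides with equal leaf sets coincide -/
lemma L_inj_aux (hT : IsBinaryPhylo n G leaf) {u v x y : V} (h : G.Adj u v) (h' : G.Adj x y)
    (hy : y ∉ W G v u) (hu : u ∈ W G x y) : L G leaf v u ≠ L G leaf x y := by
  intro heq
  have hyu : y ≠ u := by rintro rfl; exact hy (W_self _ _ _)
  by_cases hyl : y ∈ Set.range leaf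
  · obtain ⟨i, rfl⟩ := hyl
    have : i ∈ L G leaf v u := by rw [heq, mem_L]; exact W_self _ _ _
    rw [mem_L] at this; exact hy this
  · obtain ⟨p, q, h1, h2, h3, h4, h5, h6⟩ := nbrs hT h' hyl
    have main : ∀ p q, p ≠ x → q ≠ x → p ≠ q → G.Adj y p → G.Adj y q → u ∈ W G y p → False := by
      intro p q h1 h2 h3 h4 h5 hup
      obtain ⟨i, hi⟩ := L_nonempty hT h5
      have hi2 : i ∈ L G leaf x y := by
        rw [mem_L] at *
        rw [W_step hT.1 h']; exact Or.inr ⟨q, h2, h5, hi⟩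
      rw [← heq, mem_L] at hi2
      have : leaf i ∈ W G y p := W_nested hy hup hi2
      rw [mem_L] at hi
      exact W_branch_disj hT.1 h4 h5 h3 this hi
    rw [W_step hT.1 h'] at hu
    rcases hu with hu | ⟨z, hz1, hz2, hz3⟩
    · exact hyu hu.symm
    · rcases h6 z hz2 with rfl | rfl | rfl
      · exact hz1 rfl
      · exact main z q h1 h2 h3 h4 h5 hz3
      · exact main z p h2 h1 h3.symm h5 h4 hz3

lemma L_inj (hT : IsBinaryPhylo n G leaf) {u v x y : V} (h : G.Adj u v) (h' : G.Adj x y)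
    (heq : L G leaf u v = L G leaf x y) : s(u,v) = s(x,y) := by
  by_contra hne
  have hxy := W_adj h' (u := u) (v := v) (fun h => hne h.symm)
  have huv := W_adj h (u := x) (v := y) hne
  have c1 := W_compl hT.1 h
  have c2 := W_compl hT.1 h'
  obtain ⟨i, hi⟩ := L_nonempty hT h
  obtain ⟨j, hj⟩ := L_nonempty hT h.symm
  have hi' := heq ▸ hi
  have hj' : j ∈ L G leaf y x := by
    rw [L_compl hT h', ← heq, ← L_compl hT h]; exact hj
  have heq' : L G leaf v u = L G leaf y x := by
    rw [L_compl hT h', ← heq, ← L_compl hT h]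
  by_cases hx : x ∈ W G u v
  · have hy := hxy.1 hx
    by_cases hu : u ∈ W G x y
    · -- `W v u ⊆ W x y`, contradiction
      rw [mem_L] at hj hj'
      have := W_nested (y := y) ((c1 x).1 hx) hu hj
      exact (c2 _).1 this hj'
    · have hu' : u ∈ W G y x := by by_contra hc; exact hu ((c2 u).2 hc)
      exact L_inj_aux hT h h'.symm ((c1 x).1 hx) hu' heq'
  · have hy : y ∉ W G u v := fun hy => hx (hxy.2 hy)
    by_cases hu : u ∈ W G x y
    · exact L_inj_aux hT h.symm h' hy (huv.1 hu) heq
    · have hv' : v ∈ W G y x := by by_contra hc; exact hu (huv.2 ((c2 v).2 hc))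
      rw [mem_L] at hi hi'
      have := W_nested (y := x) hy hv' hi
      exact (c2 _).1 hi' this

lemma split_inj (hT : IsBinaryPhylo n G leaf) {e f : Sym2 V} (he : e ∈ G.edgeSet)
    (hf : f ∈ G.edgeSet) (h : splitOfEdge n G leaf e = splitOfEdge n G leaf f) : e = f := by
  induction e with
  | _ u v =>
  induction f with
  | _ x y =>
  rw [split_eq, split_eq, Sym2.eq_iff] at h
  rcases h with ⟨_, h⟩ | ⟨_, h⟩
  · exact L_inj hT he hf h
  · rw [L_inj hT he (SimpleGraph.Adj.symm hf) h, Sym2.eq_swap]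

lemma card_splits (hT : IsBinaryPhylo n G leaf) :
    (splitsOf n G leaf).card = G.edgeFinset.card := by
  unfold splitsOf
  apply Finset.card_image_of_injOn
  intro e he f hf h
  exact split_inj hT (by simpa using he) (by simpa using hf) h

lemma card_V (hT : IsBinaryPhylo n G leaf) : Fintype.card V + 2 = 2 * n := by
  have h1 := hT.1.card_edgeFinset
  have h2 := G.sum_degrees_eq_twice_card_edges
  have h3 : ∀ v, G.degree v = if v ∈ Finset.univ.image leaf then 1 else 3 := by
    intro v
    split_ifs with hv
    · obtain ⟨i, _, rfl⟩ := Finset.mem_image.1 hv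
      exact hT.2.2.1 i
    · exact hT.2.2.2 v (by simpa using hv)
  have h4 : (Finset.univ.image leaf).card = n := by
    rw [Finset.card_image_of_injective _ hT.2.1, Finset.card_univ, Fintype.card_fin]
  have h5 : ((Finset.univ.image leaf)ᶜ).card + n = Fintype.card V := by
    have := Finset.card_compl_add_card (Finset.univ.image leaf)
    omega
  have h6 : ∑ v, G.degree v = n + 3 * ((Finset.univ.image leaf)ᶜ).card := by
    rw [← Finset.sum_add_sum_compl (Finset.univ.image leaf)]
    congr 1
    · rw [Finset.sum_congr rfl (g := fun _ => 1)]
      · simp [h4]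
      · intro v hv; rw [h3, if_pos hv]
    · rw [Finset.sum_congr rfl (g := fun _ => 3)]
      · simp [mul_comm]
      · intro v hv; rw [h3, if_neg (by simpa using hv)]
  have h7 : ∑ v, G.degree v = 2 * G.edgeFinset.card := by convert h2
  omega

lemma card_E (hT : IsBinaryPhylo n G leaf) : G.edgeFinset.card + 3 = 2 * n := by
  have h1 := hT.1.card_edgeFinset
  have := card_V hT
  omega

end phylo
section nni
variable {V : Type}

/-- swap the subtrees hanging at `b` (from `u`) and at `c` (from `v`). -/
def swp (G : SimpleGraph V) (u v b c : V) : SimpleGraph V where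
  Adj p q := (G.Adj p q ∧ s(p,q) ≠ s(u,b) ∧ s(p,q) ≠ s(v,c)) ∨
    (p ≠ q ∧ (s(p,q) = s(u,c) ∨ s(p,q) = s(v,b)))
  symm := ⟨by
    intro p q h
    rw [Sym2.eq_swap (a := q), G.adj_comm, ne_comm (a := q)]
    exact h⟩
  loopless := ⟨by
    intro p h
    rcases h with h | h
    · exact G.loopless.irrefl p h.1
    · exact h.1 rfl⟩

lemma swp_adj (G : SimpleGraph V) (u v b c p q : V) : (swp G u v b c).Adj p q ↔
    (G.Adj p q ∧ s(p,q) ≠ s(u,b) ∧ s(p,q) ≠ s(v,c)) ∨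
    (p ≠ q ∧ (s(p,q) = s(u,c) ∨ s(p,q) = s(v,b))) := Iff.rfl

lemma swp_symm1 (G : SimpleGraph V) (u v b c : V) : swp G u v b c = swp G v u c b := by
  ext p q
  rw [swp_adj, swp_adj]
  tauto

lemma swp_symm2 (G : SimpleGraph V) (u v b c : V) : swp G u v b c = swp G b c u v := by
  ext p q
  rw [swp_adj, swp_adj, Sym2.eq_swap (a := u) (b := b), Sym2.eq_swap (a := v) (b := c),
    Sym2.eq_swap (a := u) (b := c), Sym2.eq_swap (a := v) (b := b)]
  tauto

lemma deg_aux [Fintype V] (G : SimpleGraph V) {u v b c : V} (h1 : G.Adj u b)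
    (h3 : ¬ G.Adj u c) (huv : u ≠ v) (hbc : b ≠ c) (huc : u ≠ c) :
    (swp G u v b c).degree u = G.degree u := by
  have : (swp G u v b c).neighborFinset u = insert c ((G.neighborFinset u).erase b) := by
    ext z
    simp only [SimpleGraph.mem_neighborFinset, swp_adj, Finset.mem_insert, Finset.mem_erase,
      Sym2.eq_iff]
    have := h1.ne
    grind
  rw [← SimpleGraph.card_neighborFinset_eq_degree, this, Finset.card_insert_of_notMem,
    Finset.card_erase_of_mem, SimpleGraph.card_neighborFinset_eq_degree]
  · have : 0 < G.degree u := by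
      rw [SimpleGraph.degree_pos_iff_exists_adj]; exact ⟨b, h1⟩
    omega
  · simpa using h1
  · simp [h3]

lemma deg_swp [Fintype V] (G : SimpleGraph V) {u v b c : V} (h1 : G.Adj u b) (h2 : G.Adj v c)
    (h3 : ¬ G.Adj u c) (h4 : ¬ G.Adj v b) (huv : u ≠ v) (hbc : b ≠ c) (huc : u ≠ c)
    (hvb : v ≠ b) (x : V) :
    (swp G u v b c).degree x = G.degree x := by
  by_cases hu : x = u
  · subst hu; exact deg_aux G h1 h3 huv hbc huc
  by_cases hv : x = v
  · subst hv; rw [swp_symm1]; exact deg_aux G h2 h4 huv.symm hbc.symm hvb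
  by_cases hb : x = b
  · subst hb; rw [swp_symm2]
    exact deg_aux G h1.symm (fun h => h4 h.symm) hbc huv hvb.symm
  by_cases hc : x = c
  · subst hc; rw [swp_symm2, swp_symm1]
    exact deg_aux G h2.symm (fun h => h3 h.symm) hbc.symm huv.symm huc.symm
  · have : (swp G u v b c).neighborFinset x = G.neighborFinset x := by
      ext z
      simp only [SimpleGraph.mem_neighborFinset, swp_adj, Sym2.eq_iff]
      grind
    rw [← SimpleGraph.card_neighborFinset_eq_degree, this,
      SimpleGraph.card_neighborFinset_eq_degree]

structure Conf (G : SimpleGraph V) (u v b c : V) : Prop where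
  tree : G.IsTree
  uv : G.Adj u v
  ub : G.Adj u b
  vc : G.Adj v c
  bv : b ≠ v
  cu : c ≠ u

variable {G : SimpleGraph V} {u v b c : V}

lemma Conf.sw (h : Conf G u v b c) : Conf G v u c b :=
  ⟨h.tree, h.uv.symm, h.vc, h.ub, h.cu, h.bv⟩

lemma Conf.v_notin (h : Conf G u v b c) : v ∉ W G u b := W_far h.tree h.ub h.uv h.bv

lemma Conf.c_notin (h : Conf G u v b c) : c ∉ W G u b := by
  rw [← W_adj h.vc]
  · exact h.v_notin
  · rw [ne_eq, Sym2.eq_iff]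
    have := h.uv.ne
    have := h.bv
    grind

lemma Conf.bc (h : Conf G u v b c) : b ≠ c := by
  rintro rfl; exact h.c_notin (W_self _ _ _)

lemma Conf.vb (h : Conf G u v b c) : ¬ G.Adj v b := by
  intro hv
  refine h.v_notin ((W_adj hv ?_).2 (W_self _ _ _))
  rw [ne_eq, Sym2.eq_iff]
  have := h.uv.ne
  have := h.bv
  grind

lemma Conf.adj_uv (h : Conf G u v b c) : (swp G u v b c).Adj u v := by
  rw [swp_adj]
  left
  refine ⟨h.uv, ?_, ?_⟩ <;> rw [ne_eq, Sym2.eq_iff] <;>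
  · have := h.uv.ne
    have := h.bv
    have := h.cu
    grind

lemma Conf.adj_vb (h : Conf G u v b c) : (swp G u v b c).Adj v b := by
  rw [swp_adj]
  exact Or.inr ⟨h.bv.symm, Or.inr rfl⟩

lemma Conf.adj_uc (h : Conf G u v b c) : (swp G u v b c).Adj u c := by
  rw [swp_adj]
  exact Or.inr ⟨h.cu.symm, Or.inl rfl⟩

lemma Conf.conn (h : Conf G u v b c) : (swp G u v b c).Connected := by
  have := h.tree.1.nonempty
  refine ⟨fun x y => ?_⟩
  refine reach_mem (H := G) (P := {z | (swp G u v b c).Reachable x z}) ?_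
    (h.tree.1.preconnected x y) (Reachable.refl x)
  intro p q hpq hp
  refine Reachable.trans hp ?_
  have r1 : (swp G u v b c).Reachable u b := h.adj_uv.reachable.trans h.adj_vb.reachable
  have r2 : (swp G u v b c).Reachable v c := h.adj_uv.symm.reachable.trans h.adj_uc.reachable
  by_cases e1 : s(p,q) = s(u,b)
  · rw [Sym2.eq_iff] at e1
    rcases e1 with ⟨rfl, rfl⟩ | ⟨rfl, rfl⟩
    · exact r1
    · exact r1.symm
  by_cases e2 : s(p,q) = s(v,c)
  · rw [Sym2.eq_iff] at e2
    rcases e2 with ⟨rfl, rfl⟩ | ⟨rfl, rfl⟩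
    · exact r2
    · exact r2.symm
  exact Adj.reachable (Or.inl ⟨hpq, e1, e2⟩)

lemma Conf.deg [Fintype V] (h : Conf G u v b c) (x : V) :
    (swp G u v b c).degree x = G.degree x :=
  deg_swp G h.ub h.vc h.sw.vb h.vb h.uv.ne h.bc h.cu.symm h.bv.symm x

lemma Conf.isTree [Fintype V] (h : Conf G u v b c) : (swp G u v b c).IsTree := by
  rw [isTree_iff_connected_and_card]
  refine ⟨h.conn, ?_⟩
  have h1 := h.tree.card_edgeFinset
  have h2 := G.sum_degrees_eq_twice_card_edges
  have h3 := (swp G u v b c).sum_degrees_eq_twice_card_edges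
  have h4 : ∑ x, (swp G u v b c).degree x = ∑ x, G.degree x :=
    Finset.sum_congr rfl (fun x _ => h.deg x)
  rw [Nat.card_eq_fintype_card, Nat.card_eq_fintype_card, ← edgeFinset_card]
  omega

/-- `W` for an unaffected edge -/
lemma Conf.W_other [Fintype V] (h : Conf G u v b c) {p q : V} (hpq : G.Adj p q)
    (e0 : s(p,q) ≠ s(u,v)) (e1 : s(p,q) ≠ s(u,b)) (e2 : s(p,q) ≠ s(v,c)) (w : V) :
    w ∈ W (swp G u v b c) p q ↔ w ∈ W G p q := by
  have a0 := W_adj h.uv e0.symm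
  have a1 := W_adj h.ub e1.symm
  have a2 := W_adj h.vc e2.symm
  refine W_char h.isTree (Or.inl ⟨hpq, e1, e2⟩) (W_self _ _ _) (W_notself h.tree hpq) ?_ w
  rintro x y (hxy | hxy) hne hx
  · exact (W_adj hxy.1 hne).1 hx
  · simp only [Sym2.eq_iff] at hxy
    rcases hxy.2 with (⟨rfl, rfl⟩ | ⟨rfl, rfl⟩) | (⟨rfl, rfl⟩ | ⟨rfl, rfl⟩) <;> tauto

lemma Conf.W_b [Fintype V] (h : Conf G u v b c) (w : V) :
    w ∈ W (swp G u v b c) v b ↔ w ∈ W G u b := by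
  have a1 := h.v_notin
  have a2 := h.c_notin
  have a3 := W_notself h.tree h.ub
  refine W_char h.isTree h.adj_vb (W_self _ _ _) a1 ?_ w
  rintro x y (hxy | hxy) hne hx
  · exact (W_adj hxy.1 hxy.2.1).1 hx
  · simp only [Sym2.eq_iff] at hxy hne
    rcases hxy.2 with (⟨rfl, rfl⟩ | ⟨rfl, rfl⟩) | (⟨rfl, rfl⟩ | ⟨rfl, rfl⟩) <;>
      first | tauto | exact absurd Sym2.eq_swap hne

lemma Conf.W_e [Fintype V] (h : Conf G u v b c) (w : V) :
    w ∈ W (swp G u v b c) v u ↔ (w ∈ W G v u ∧ w ∉ W G u b) ∨ w ∈ W G v c := by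
  have a1 := h.v_notin
  have a2 := h.c_notin
  have a3 := W_notself h.tree h.ub
  have b1 := h.sw.v_notin
  have b2 := h.sw.c_notin
  have b3 := W_notself h.tree h.vc
  have b4 := W_notself h.tree h.uv.symm
  refine W_char (P := {w | (w ∈ W G v u ∧ w ∉ W G u b) ∨ w ∈ W G v c})
    h.isTree h.adj_uv.symm (Or.inl ⟨W_self _ _ _, a3⟩) ?_ ?_ w
  · rintro (h | h)
    · exact b4 h.1
    · exact b3 h
  · rintro x y (hxy | hxy) hne hx
    · have c1 := W_adj hxy.1 hxy.2.1
      have c2 := W_adj hxy.1 hxy.2.2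
      have c3 := W_adj hxy.1 hne
      simp only [Set.mem_ofPred_eq] at hx ⊢
      tauto
    · simp only [Sym2.eq_iff] at hxy hne
      have s1 := W_self G u b
      have s2 := W_self G v c
      have s3 := W_self G v u
      have s4 := W_self G u v
      simp only [Set.mem_ofPred_eq] at hx ⊢
      rcases hxy.2 with (⟨rfl, rfl⟩ | ⟨rfl, rfl⟩) | (⟨rfl, rfl⟩ | ⟨rfl, rfl⟩) <;> tauto

lemma Conf.phylo [Fintype V] {n : ℕ} {leaf : Fin n → V} (h : Conf G u v b c)
    (hT : IsBinaryPhylo n G leaf) : IsBinaryPhylo n (swp G u v b c) leaf := by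
  refine ⟨h.isTree, hT.2.1, ?_, ?_⟩
  · intro i; rw [h.deg]; exact hT.2.2.1 i
  · intro x hx; rw [h.deg]; exact hT.2.2.2 x hx

lemma Conf.splits [Fintype V] {n : ℕ} {leaf : Fin n → V} (h : Conf G u v b c)
    (hT : IsBinaryPhylo n G leaf) {X : Finset (Fin n)}
    (hX : ∀ i, i ∈ X ↔ (i ∈ L G leaf v u ∧ i ∉ L G leaf u b) ∨ i ∈ L G leaf v c)
    (hXT : s(X, Xᶜ) ∉ splitsOf n G leaf) :
    splitsOf n (swp G u v b c) leaf =
      insert s(X, Xᶜ) ((splitsOf n G leaf).erase s(L G leaf u v, (L G leaf u v)ᶜ)) := by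
  have hT' := h.phylo hT
  symm
  apply Finset.eq_of_subset_of_card_le
  · intro σ hσ
    rw [Finset.mem_insert, Finset.mem_erase] at hσ
    rcases hσ with rfl | ⟨hne, hσ⟩
    · rw [mem_splits' hT']
      refine ⟨v, u, h.adj_uv.symm, ?_⟩
      ext i
      rw [hX, mem_L, mem_L, mem_L, mem_L, h.W_e]
    · rw [mem_splits hT] at hσ
      obtain ⟨p, q, hpq, rfl⟩ := hσ
      have swap : ∀ x y, G.Adj x y → s(p,q) = s(x,y) →
          s(L G leaf p q, (L G leaf p q)ᶜ) = s(L G leaf x y, (L G leaf x y)ᶜ) := by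
        intro x y hxy he
        rw [Sym2.eq_iff] at he
        rcases he with ⟨rfl, rfl⟩ | ⟨rfl, rfl⟩
        · rfl
        · rw [cs_eq]; right; exact L_compl hT hxy
      by_cases e0 : s(p,q) = s(u,v)
      · exact absurd (swap _ _ h.uv e0) hne
      by_cases e1 : s(p,q) = s(u,b)
      · rw [swap _ _ h.ub e1, mem_splits' hT']
        refine ⟨v, b, h.adj_vb, ?_⟩
        ext i; rw [mem_L, mem_L, h.W_b]
      by_cases e2 : s(p,q) = s(v,c)
      · rw [swap _ _ h.vc e2, mem_splits' hT']
        refine ⟨u, c, h.adj_uc, ?_⟩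
        ext i; rw [mem_L, mem_L, swp_symm1, h.sw.W_b]
      · rw [mem_splits' hT']
        refine ⟨p, q, Or.inl ⟨hpq, e1, e2⟩, ?_⟩
        ext i; rw [mem_L, mem_L, h.W_other hpq e0 e1 e2]
  · have hm : s(L G leaf u v, (L G leaf u v)ᶜ) ∈ splitsOf n G leaf :=
      (mem_splits' hT _).2 ⟨u, v, h.uv, rfl⟩
    rw [Finset.card_insert_of_notMem (fun hc => hXT (Finset.mem_of_mem_erase hc)),
      Finset.card_erase_of_mem hm, card_splits hT, card_splits hT']
    have := card_E hT
    have := card_E hT'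
    omega

end nni
section transfer
variable {V V' : Type} [Fintype V] [Fintype V'] {n : ℕ}

lemma W_iso {G : SimpleGraph V} {G' : SimpleGraph V'} (φ : G ≃g G') (u v w : V) :
    φ w ∈ W G' (φ u) (φ v) ↔ w ∈ W G u v := by
  let ψ : G.deleteEdges {s(u,v)} ≃g G'.deleteEdges {s(φ u, φ v)} :=
    ⟨φ.toEquiv, by
      intro a b
      simp only [deleteEdges_adj, Set.mem_singleton_iff, Sym2.eq_iff, RelIso.coe_fn_toEquiv,
        EmbeddingLike.apply_eq_iff_eq]
      rw [φ.map_adj_iff]⟩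
  exact Iso.reachable_iff (φ := ψ)

lemma splits_iso {G : SimpleGraph V} {G' : SimpleGraph V'} (φ : G ≃g G') {leaf : Fin n → V}
    {leaf' : Fin n → V'} (hl : ∀ i, φ (leaf i) = leaf' i) (hT : IsBinaryPhylo n G leaf) :
    IsBinaryPhylo n G' leaf' ∧ splitsOf n G' leaf' = splitsOf n G leaf := by
  have hT' : IsBinaryPhylo n G' leaf' := by
    refine ⟨φ.isTree_iff.1 hT.1, ?_, ?_, ?_⟩
    · intro i j h
      rw [← hl, ← hl] at h
      exact hT.2.1 (φ.injective h)
    · intro i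
      rw [← hl, ← hT.2.2.1 i]; convert φ.degree_eq _
    · intro v hv
      obtain ⟨w, rfl⟩ := φ.surjective v
      rw [← hT.2.2.2 w]
      · convert φ.degree_eq _
      · rintro ⟨i, rfl⟩
        exact hv ⟨i, (hl i).symm⟩
  refine ⟨hT', ?_⟩
  have hL : ∀ u v, L G' leaf' (φ u) (φ v) = L G leaf u v := by
    intro u v
    ext i
    rw [mem_L, mem_L, ← hl, W_iso]
  ext σ
  rw [mem_splits hT, mem_splits hT']
  constructor
  · rintro ⟨u, v, h, rfl⟩
    obtain ⟨u, rfl⟩ := φ.surjective u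
    obtain ⟨v, rfl⟩ := φ.surjective v
    exact ⟨u, v, φ.map_adj_iff.1 h, by rw [hL]⟩
  · rintro ⟨u, v, h, rfl⟩
    exact ⟨φ u, φ v, φ.map_adj_iff.2 h, by rw [hL]⟩

lemma mem_all {G : SimpleGraph V} {leaf : Fin n → V} (hn : 4 ≤ n) (hT : IsBinaryPhylo n G leaf) :
    splitsOf n G leaf ∈ allBPTSplits n := by
  unfold allBPTSplits
  rw [Finset.mem_filter]
  refine ⟨Finset.mem_univ _, ?_⟩
  let e1 : Fin n ≃ {v // v ∈ Set.range leaf} := Equiv.ofInjective leaf hT.2.1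
  have hc : Fintype.card {v // ¬ (v ∈ Set.range leaf)} = n - 2 := by
    rw [Fintype.card_subtype_compl, ← Fintype.card_congr e1, Fintype.card_fin]
    have := card_V hT
    omega
  let e2 : {v // ¬ (v ∈ Set.range leaf)} ≃ Fin (n-2) := Fintype.equivFinOfCardEq hc
  let e : Fin n ⊕ Fin (n-2) ≃ V :=
    (Equiv.sumCongr e1 e2.symm).trans (Equiv.sumCompl (fun v => v ∈ Set.range leaf))
  have he : ∀ i, e (Sum.inl i) = leaf i := by
    intro i
    simp [e, e1]
  let φ : G.comap e ≃g G := ⟨e, Iff.rfl⟩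
  have := splits_iso φ.symm (leaf := leaf) (leaf' := Sum.inl) ?_ hT
  · exact ⟨G.comap e, this⟩
  · intro i
    rw [← he]
    exact e.symm_apply_apply _

end transfer
section sets
variable {n : ℕ}

lemma set3 {A B X : Finset (Fin n)} (hd : ∀ i, i ∈ A → i ∉ B)
    (mo : (A ∪ B ⊆ X ∨ A ∪ B ⊆ Xᶜ) ∨ ((A ∪ B)ᶜ ⊆ X ∨ (A ∪ B)ᶜ ⊆ Xᶜ))
    (ma : A ⊆ X ∨ A ⊆ Xᶜ) (mb : B ⊆ X ∨ B ⊆ Xᶜ)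
    (k1 : X ≠ A) (k2 : X ≠ Aᶜ) (k3 : X ≠ B) (k4 : X ≠ Bᶜ) :
    A ∪ B ⊆ X ∨ A ∪ B ⊆ Xᶜ := by
  rcases mo with mo | mo
  · exact mo
  simp only [Finset.subset_iff, Finset.mem_compl, Finset.mem_union] at *
  rcases ma with ma | ma <;> rcases mb with mb | mb
  · left; intro i hi; exact hi.elim (@ma i) (@mb i)
  · exfalso
    rcases mo with mo | mo
    · apply k4; ext i
      have := @mo i; have := @ma i; have := @mb i; have := hd i
      rw [Finset.mem_compl]; tauto
    · apply k1; ext i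
      have := @mo i; have := @ma i; have := @mb i; have := hd i
      tauto
  · exfalso
    rcases mo with mo | mo
    · apply k2; ext i
      have := @mo i; have := @ma i; have := @mb i; have := hd i
      rw [Finset.mem_compl]; tauto
    · apply k3; ext i
      have := @mo i; have := @ma i; have := @mb i; have := hd i
      tauto
  · right; intro i hi; exact hi.elim (@ma i) (@mb i)

lemma set4 {A B C D X : Finset (Fin n)} (d1 : ∀ i, i ∈ A → i ∉ B) (d2 : ∀ i, i ∈ C → i ∉ D)
    (f : ∀ i, i ∈ A ∨ i ∈ B ↔ ¬ (i ∈ C ∨ i ∈ D))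
    (ma : A ⊆ X ∨ A ⊆ Xᶜ) (mb : B ⊆ X ∨ B ⊆ Xᶜ) (mc : C ⊆ X ∨ C ⊆ Xᶜ) (md : D ⊆ X ∨ D ⊆ Xᶜ)
    (p1 : X ≠ A) (p2 : X ≠ Aᶜ) (p3 : X ≠ B) (p4 : X ≠ Bᶜ) (p5 : X ≠ C) (p6 : X ≠ Cᶜ)
    (p7 : X ≠ D) (p8 : X ≠ Dᶜ) (p9 : X ≠ C ∪ D) (p10 : X ≠ (C ∪ D)ᶜ)
    (h0 : X.Nonempty) (h1 : Xᶜ.Nonempty) :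
    (X = A ∪ C ∨ X = (A ∪ C)ᶜ) ∨ (X = A ∪ D ∨ X = (A ∪ D)ᶜ) := by
  have q0 : X ≠ ∅ := h0.ne_empty
  have q1 : X ≠ Finset.univ := by
    rintro rfl; simp at h1
  simp only [Finset.subset_iff, Finset.mem_compl] at ma mb mc md
  rcases ma with ma | ma <;> rcases mb with mb | mb <;> rcases mc with mc | mc <;>
    rcases md with md | md
  on_goal 1 => refine absurd ?_ q1
  on_goal 2 => refine absurd ?_ p8
  on_goal 3 => refine absurd ?_ p6
  on_goal 4 => refine absurd ?_ p10
  on_goal 5 => refine absurd ?_ p4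
  on_goal 6 => refine Or.inl (Or.inl ?_)
  on_goal 7 => refine Or.inr (Or.inl ?_)
  on_goal 8 => refine absurd ?_ p1
  on_goal 9 => refine absurd ?_ p2
  on_goal 10 => refine Or.inr (Or.inr ?_)
  on_goal 11 => refine Or.inl (Or.inr ?_)
  on_goal 12 => refine absurd ?_ p3
  on_goal 13 => refine absurd ?_ p9
  on_goal 14 => refine absurd ?_ p5
  on_goal 15 => refine absurd ?_ p7
  on_goal 16 => refine absurd ?_ q0
  all_goals
    ext i
    have a1 := d1 i
    have a2 := d2 i
    have a3 := f i
    have a4 := @ma i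
    have a5 := @mb i
    have a6 := @mc i
    have a7 := @md i
    clear d1 d2 f ma mb mc md p1 p2 p3 p4 p5 p6 p7 p8 p9 p10 h0 h1 q0 q1
    try simp only [Finset.mem_union, Finset.mem_compl, Finset.mem_univ, Finset.notMem_empty]
    by_cases i ∈ A <;> by_cases i ∈ C <;> by_cases i ∈ D <;> by_cases i ∈ X <;> simp_all

end sets
section main
variable {V : Type} [Fintype V] {n : ℕ} {G : SimpleGraph V} {leaf : Fin n → V}

lemma mono_aux (hT : IsBinaryPhylo n G leaf) {X : Finset (Fin n)} {e : Sym2 V}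
    (hc : ∀ p q, G.Adj p q → s(p,q) ≠ e →
      ((L G leaf p q ⊆ X ∨ L G leaf p q ⊆ Xᶜ) ∨ (L G leaf q p ⊆ X ∨ L G leaf q p ⊆ Xᶜ)))
    (hX : s(X, Xᶜ) ∉ splitsOf n G leaf) :
    ∀ k : ℕ, ∀ p q, (L G leaf p q).card ≤ k → G.Adj p q →
      (∀ x y, G.Adj x y → L G leaf x y ⊆ L G leaf p q → s(x,y) ≠ e) →
      (L G leaf p q ⊆ X ∨ L G leaf p q ⊆ Xᶜ) := by
  intro k
  induction k with
  | zero =>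
    intro p q hk h _
    left
    rw [Finset.card_eq_zero.1 (Nat.le_zero.1 hk)]; exact Finset.empty_subset _
  | succ k ih =>
    intro p q hk h he
    by_cases hq : q ∈ Set.range leaf
    · obtain ⟨i, rfl⟩ := hq
      rw [L_leaf hT h]
      by_cases hi : i ∈ X
      · left; simpa using hi
      · right; simpa using hi
    obtain ⟨x, y, h1, h2, h3, h4, h5, h6⟩ := nbrs hT h hq
    have hu := L_step hT h hq h1 h2 h4 h5 h6
    have hd := fun i => L_disj hT h4 h5 h3 (i := i)
    obtain ⟨i, hi⟩ := L_nonempty hT h4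
    obtain ⟨j, hj⟩ := L_nonempty hT h5
    have hsx : L G leaf q x ⊂ L G leaf p q := by
      rw [Finset.ssubset_iff_of_subset (by rw [hu]; exact Finset.subset_union_left)]
      exact ⟨j, by rw [hu]; exact Finset.mem_union_right _ hj, fun hh => hd j hh hj⟩
    have hsy : L G leaf q y ⊂ L G leaf p q := by
      rw [Finset.ssubset_iff_of_subset (by rw [hu]; exact Finset.subset_union_right)]
      exact ⟨i, by rw [hu]; exact Finset.mem_union_left _ hi, fun hh => hd i hi hh⟩
    have cx := Finset.card_lt_card hsx
    have cy := Finset.card_lt_card hsy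
    have mx := ih q x (by omega) h4 (fun x' y' ha hb => he x' y' ha (hb.trans hsx.1))
    have my := ih q y (by omega) h5 (fun x' y' ha hb => he x' y' ha (hb.trans hsy.1))
    have mo := hc p q h (he p q h subset_rfl)
    have hcq := L_compl hT h
    have n1 : ∀ a b, G.Adj a b → X ≠ L G leaf a b := by
      intro a b hab hXa
      exact hX ((mem_splits' hT X).2 ⟨a, b, hab, hXa⟩)
    have n2 : ∀ a b, G.Adj a b → X ≠ (L G leaf a b)ᶜ := by
      intro a b hab
      rw [← L_compl hT hab]; exact n1 b a hab.symm
    have k1 := n1 _ _ h4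
    have k2 := n2 _ _ h4
    have k3 := n1 _ _ h5
    have k4 := n2 _ _ h5
    rw [hcq, hu] at mo
    rw [hu]
    exact set3 hd mo mx my k1 k2 k3 k4

/-- combinatorial core -/
lemma quad (hT : IsBinaryPhylo n G leaf) {u v a b c d : V}
    (huv : G.Adj u v) (hu : u ∉ Set.range leaf) (hv : v ∉ Set.range leaf)
    (ha : G.Adj u a) (hb : G.Adj u b) (hc : G.Adj v c) (hd : G.Adj v d)
    (hav : a ≠ v) (hbv : b ≠ v) (hcu : c ≠ u) (hdu : d ≠ u) (hab : a ≠ b) (hcd : c ≠ d)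
    (hnu : ∀ z, G.Adj u z → z = v ∨ z = a ∨ z = b)
    (hnv : ∀ z, G.Adj v z → z = u ∨ z = c ∨ z = d) (X : Finset (Fin n))
    (hcmp : ∀ p q, G.Adj p q → s(p,q) ≠ s(u,v) →
      ((L G leaf p q ⊆ X ∨ L G leaf p q ⊆ Xᶜ) ∨ (L G leaf q p ⊆ X ∨ L G leaf q p ⊆ Xᶜ)))
    (hX : s(X, Xᶜ) ∉ splitsOf n G leaf) (hX0 : X.Nonempty) (hX1 : Xᶜ.Nonempty) :
    (X = L G leaf u a ∪ L G leaf v c ∨ X = (L G leaf u a ∪ L G leaf v c)ᶜ) ∨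
    (X = L G leaf u a ∪ L G leaf v d ∨ X = (L G leaf u a ∪ L G leaf v d)ᶜ) := by
  have e1 := L_step hT huv.symm hu hav hbv ha hb hnu
  have e2 := L_step hT huv hv hcu hdu hc hd hnv
  have e3 := L_compl hT huv
  have d1 := fun i => L_disj hT ha hb hab (i := i)
  have d2 := fun i => L_disj hT hc hd hcd (i := i)
  obtain ⟨ia, hia⟩ := L_nonempty hT ha
  obtain ⟨ib, hib⟩ := L_nonempty hT hb
  obtain ⟨ic, hic⟩ := L_nonempty hT hc
  obtain ⟨id, hid⟩ := L_nonempty hT hd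
  have key : ∀ p q, G.Adj p q → ¬ (L G leaf u v ⊆ L G leaf p q) → ¬ (L G leaf v u ⊆ L G leaf p q) →
      (L G leaf p q ⊆ X ∨ L G leaf p q ⊆ Xᶜ) := by
    intro p q h k1 k2
    refine mono_aux hT hcmp hX _ p q le_rfl h ?_
    intro x y hxy hs he
    rw [Sym2.eq_iff] at he
    rcases he with ⟨rfl, rfl⟩ | ⟨rfl, rfl⟩
    · exact k1 hs
    · exact k2 hs
  have n1 : ∀ a b, G.Adj a b → X ≠ L G leaf a b := by
    intro a b hab hXa
    exact hX ((mem_splits' hT X).2 ⟨a, b, hab, hXa⟩)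
  have n2 : ∀ a b, G.Adj a b → X ≠ (L G leaf a b)ᶜ := by
    intro a b hab
    rw [← L_compl hT hab]; exact n1 b a hab.symm
  have p1 := n1 _ _ ha
  have p2 := n2 _ _ ha
  have p3 := n1 _ _ hb
  have p4 := n2 _ _ hb
  have p5 := n1 _ _ hc
  have p6 := n2 _ _ hc
  have p7 := n1 _ _ hd
  have p8 := n2 _ _ hd
  have p9 := n1 _ _ huv
  have p10 := n2 _ _ huv
  have ma := key _ _ ha
  have mb := key _ _ hb
  have mc := key _ _ hc
  have md := key _ _ hd
  rw [e3, e2] at ma mb mc md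
  rw [e2] at p9 p10
  rw [e3, e2] at e1
  have f1 : ∀ i, i ∈ L G leaf u a ∨ i ∈ L G leaf u b ↔ ¬ (i ∈ L G leaf v c ∨ i ∈ L G leaf v d) := by
    intro i
    have := congrArg (fun s => i ∈ s) e1
    simpa using this.symm
  have ga := f1 ia
  have gb := f1 ib
  have da := d1 ia
  have db := d1 ib
  have dc := d2 ic
  have dd := d2 id
  have gc := f1 ic
  have gd := f1 id
  have ka : ia ∈ (L G leaf v c ∪ L G leaf v d)ᶜ := by rw [e1]; exact Finset.mem_union_left _ hia
  have kb : ib ∈ (L G leaf v c ∪ L G leaf v d)ᶜ := by rw [e1]; exact Finset.mem_union_right _ hib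
  have kc : ic ∈ (L G leaf v c ∪ L G leaf v d) := Finset.mem_union_left _ hic
  have kd : id ∈ (L G leaf v c ∪ L G leaf v d) := Finset.mem_union_right _ hid
  refine set4 d1 d2 f1 (ma ?_ ?_) (mb ?_ ?_) (mc ?_ ?_) (md ?_ ?_) p1 p2 p3 p4 p5 p6 p7 p8 p9 p10
    hX0 hX1
  · intro hs; exact gc.1 (Or.inl (hs kc)) (Or.inl hic)
  · intro hs; exact d1 ib (hs kb) hib
  · intro hs; exact gc.1 (Or.inr (hs kc)) (Or.inl hic)
  · intro hs; exact d1 ia hia (hs ka)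
  · intro hs; exact d2 id (hs kd) hid
  · intro hs; exact ga.1 (Or.inl hia) (Or.inl (hs ka))
  · intro hs; exact d2 ic hic (hs kc)
  · intro hs; exact ga.1 (Or.inl hia) (Or.inr (hs ka))

end main
section final
variable {V : Type} [Fintype V] {n : ℕ} {G : SimpleGraph V} {leaf : Fin n → V}

lemma prop_aux {a b c : Prop} (h : a → ¬ b) : a ∨ c ↔ ((a ∨ b) ∧ ¬ b) ∨ c := by tauto

lemma split_eq' (hT : IsBinaryPhylo n G leaf) {u v : V} (h : G.Adj u v) :
    splitOfEdge n G leaf s(u,v) = s(L G leaf u v, (L G leaf u v)ᶜ) := by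
  rw [split_eq, L_compl hT h, Sym2.eq_swap]

lemma mem_all_iff {S : Finset (Sym2 (Finset (Fin n)))} (h : S ∈ allBPTSplits n) :
    ∃ G : SimpleGraph (Fin n ⊕ Fin (n - 2)),
    IsBinaryPhylo n G Sum.inl ∧ splitsOf n G Sum.inl = S := by
  unfold allBPTSplits at h
  exact (Finset.mem_filter.1 h).2

lemma notin4 (hT : IsBinaryPhylo n G leaf) {A B C D : Finset (Fin n)}
    (hσ : s(C ∪ D, (C ∪ D)ᶜ) ∈ splitsOf n G leaf)
    (d1 : ∀ i, i ∈ A → i ∉ B) (d2 : ∀ i, i ∈ C → i ∉ D)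
    (f : ∀ i, i ∈ A ∨ i ∈ B ↔ ¬ (i ∈ C ∨ i ∈ D))
    (ha : A.Nonempty) (hb : B.Nonempty) (hc : C.Nonempty) (hd : D.Nonempty) :
    s(A ∪ C, (A ∪ C)ᶜ) ∉ splitsOf n G leaf := by
  intro h
  obtain ⟨a, ha⟩ := ha
  obtain ⟨b, hb⟩ := hb
  obtain ⟨c, hc⟩ := hc
  obtain ⟨d, hd⟩ := hd
  have fa := (f a).1 (Or.inl ha)
  have fb := (f b).1 (Or.inr hb)
  have fc : ¬ (c ∈ A ∨ c ∈ B) := fun hh => (f c).1 hh (Or.inl hc)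
  have fd : ¬ (d ∈ A ∨ d ∈ B) := fun hh => (f d).1 hh (Or.inr hd)
  have da := d1 a ha
  have db : b ∉ A := fun hh => d1 b hh hb
  have dc := d2 c hc
  have dd : d ∉ C := fun hh => d2 d hh hd
  push Not at fa fb fc fd
  have := compat_splits hT h hσ
  simp only [Finset.subset_iff, Finset.mem_compl, Finset.mem_union] at this
  rcases this with (h | h) | (h | h)
  · have := h (Or.inr hd); simp_all
  · have := h (Or.inl hc); simp_all
  · have := @h b (by simp_all); simp_all
  · have := @h a (by simp_all); simp_all

lemma ne4 {A B C D : Finset (Fin n)}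
    (d1 : ∀ i, i ∈ A → i ∉ B) (d2 : ∀ i, i ∈ C → i ∉ D)
    (f : ∀ i, i ∈ A ∨ i ∈ B ↔ ¬ (i ∈ C ∨ i ∈ D))
    (ha : A.Nonempty) (hc : C.Nonempty) :
    s(A ∪ C, (A ∪ C)ᶜ) ≠ s(A ∪ D, (A ∪ D)ᶜ) := by
  obtain ⟨a, ha⟩ := ha
  obtain ⟨c, hc⟩ := hc
  have fc : ¬ (c ∈ A ∨ c ∈ B) := fun hh => (f c).1 hh (Or.inl hc)
  have dc := d2 c hc
  rw [Ne, cs_eq]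
  rintro (h | h)
  · have : c ∈ A ∪ D := h ▸ Finset.mem_union_right _ hc
    rw [Finset.mem_union] at this
    rcases this with h | h
    · exact fc (Or.inl h)
    · exact dc h
  · have : a ∈ (A ∪ D)ᶜ := h ▸ Finset.mem_union_left _ ha
    rw [Finset.mem_compl] at this
    exact this (Finset.mem_union_left _ ha)

lemma main_e (hn : 4 ≤ n) (hT : IsBinaryPhylo n G leaf) {u v : V} (huv : G.Adj u v)
    (hu : u ∉ Set.range leaf) (hv : v ∉ Set.range leaf) :
    ∃ τ₁ τ₂, τ₁ ≠ τ₂ ∧ τ₁ ∉ splitsOf n G leaf ∧ τ₂ ∉ splitsOf n G leaf ∧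
      ∀ τ, τ ∉ splitsOf n G leaf →
        (insert τ ((splitsOf n G leaf).erase (splitOfEdge n G leaf s(u,v))) ∈ allBPTSplits n ↔
          τ = τ₁ ∨ τ = τ₂) := by
  obtain ⟨a, b, hav, hbv, hab, ha, hb, hnu⟩ := nbrs hT huv.symm hu
  obtain ⟨c, d, hcu, hdu, hcd, hc, hd, hnv⟩ := nbrs hT huv hv
  have e1 := L_step hT huv.symm hu hav hbv ha hb hnu
  have e2 := L_step hT huv hv hcu hdu hc hd hnv
  have e3 := L_compl hT huv
  have d1 := fun i => L_disj hT ha hb hab (i := i)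
  have d2 := fun i => L_disj hT hc hd hcd (i := i)
  have d2' := fun i => L_disj hT hd hc hcd.symm (i := i)
  have na := L_nonempty hT ha
  have nb := L_nonempty hT hb
  have nc := L_nonempty hT hc
  have nd := L_nonempty hT hd
  have e4 := e3
  rw [e1, e2] at e4
  have f : ∀ i, i ∈ L G leaf u a ∨ i ∈ L G leaf u b ↔ ¬ (i ∈ L G leaf v c ∨ i ∈ L G leaf v d) := by
    intro i
    have := congrArg (fun s => i ∈ s) e4
    simpa using this
  have f' : ∀ i, i ∈ L G leaf u a ∨ i ∈ L G leaf u b ↔ ¬ (i ∈ L G leaf v d ∨ i ∈ L G leaf v c) := by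
    intro i
    rw [f i, or_comm]
  have hσ : s(L G leaf u v, (L G leaf u v)ᶜ) ∈ splitsOf n G leaf :=
    (mem_splits' hT _).2 ⟨u, v, huv, rfl⟩
  have hσ1 := hσ
  rw [e2] at hσ1
  have hσ2 := hσ1
  rw [Finset.union_comm] at hσ2
  have t1 := notin4 hT hσ1 d1 d2 f na nb nc nd
  have t2 := notin4 hT hσ2 d1 d2' f' na nb nd nc
  refine ⟨_, _, ne4 d1 d2 f na nc, t1, t2, ?_⟩
  intro τ hτ
  rw [split_eq' hT huv]
  constructor
  · intro hS
    obtain ⟨G', hT', hG'⟩ := mem_all_iff hS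
    have h1 : τ ∈ splitsOf n G' Sum.inl := by rw [hG']; exact Finset.mem_insert_self _ _
    have h1' := h1
    rw [mem_splits hT'] at h1
    obtain ⟨x, y, hxy, rfl⟩ := h1
    have hcmp : ∀ p q, G.Adj p q → s(p,q) ≠ s(u,v) →
      ((L G leaf p q ⊆ L G' Sum.inl x y ∨ L G leaf p q ⊆ (L G' Sum.inl x y)ᶜ) ∨
      (L G leaf q p ⊆ L G' Sum.inl x y ∨ L G leaf q p ⊆ (L G' Sum.inl x y)ᶜ)) := by
      intro p q hpq hne
      rw [L_compl hT hpq]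
      refine compat_splits hT' h1' ?_
      rw [hG']
      apply Finset.mem_insert_of_mem
      rw [Finset.mem_erase]
      refine ⟨?_, (mem_splits' hT _).2 ⟨p, q, hpq, rfl⟩⟩
      rw [← split_eq' hT hpq, ← split_eq' hT huv]
      intro hh
      exact hne (split_inj hT hpq huv hh)
    have := quad hT huv hu hv ha hb hc hd hav hbv hcu hdu hab hcd hnu hnv _ hcmp hτ
      (L_nonempty hT' hxy) (by rw [← L_compl hT' hxy]; exact L_nonempty hT' hxy.symm)
    rw [cs_eq, cs_eq]
    exact this
  · rintro (rfl | rfl)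
    · have cf : Conf G u v b c := ⟨hT.1, huv, hb, hc, hbv, hcu⟩
      rw [← cf.splits hT ?_ t1]
      · exact mem_all hn (cf.phylo hT)
      · intro i
        rw [e1, Finset.mem_union, Finset.mem_union]
        exact prop_aux (d1 i)
    · have cf : Conf G u v b d := ⟨hT.1, huv, hb, hd, hbv, hdu⟩
      rw [← cf.splits hT ?_ t2]
      · exact mem_all hn (cf.phylo hT)
      · intro i
        rw [e1, Finset.mem_union, Finset.mem_union]
        exact prop_aux (d1 i)

lemma triv_mem (hT : IsBinaryPhylo n G leaf) (i : Fin n) : s({i}, {i}ᶜ) ∈ splitsOf n G leaf := by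
  obtain ⟨u, hu⟩ := leaf_adj hT i
  exact (mem_splits' hT _).2 ⟨u, leaf i, hu, (L_leaf hT hu).symm⟩

/-- the pendant edges -/
lemma card_internal (hn : 4 ≤ n) (hT : IsBinaryPhylo n G leaf) :
    (internalEdgesG n G leaf).card = n - 3 := by
  have hE := card_E hT
  choose g hg using leaf_adj hT
  have hp : (G.edgeFinset.filter (fun e => ¬ ∀ v ∈ e, v ∉ Set.range leaf)) =
      Finset.univ.image (fun i => s(g i, leaf i)) := by
    ext e
    induction e with
    | _ x y =>
    simp only [Finset.mem_filter, Finset.mem_image, Finset.mem_univ, true_and,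
      SimpleGraph.mem_edgeFinset, SimpleGraph.mem_edgeSet]
    constructor
    · rintro ⟨hxy, h⟩
      push Not at h
      obtain ⟨v, hv, i, rfl⟩ := h
      refine ⟨i, ?_⟩
      rw [Sym2.mem_iff] at hv
      rcases hv with rfl | rfl
      · rw [leaf_nbr hT (hg i) hxy, Sym2.eq_swap]
      · rw [leaf_nbr hT (hg i) hxy.symm]
    · rintro ⟨i, hi⟩
      constructor
      · have : s(g i, leaf i) ∈ G.edgeSet := hg i
        rw [hi] at this
        exact this
      · intro h
        exact h (leaf i) (hi ▸ Sym2.mem_mk_right _ _) ⟨i, rfl⟩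
  have hc : (Finset.univ.image (fun i => s(g i, leaf i))).card = n := by
    rw [Finset.card_image_of_injective, Finset.card_univ, Fintype.card_fin]
    intro i j hij
    have h2 := congrArg (splitOfEdge n G leaf) hij
    simp only [] at h2
    rw [split_eq' hT (hg i), split_eq' hT (hg j), L_leaf hT (hg i), L_leaf hT (hg j), cs_eq] at h2
    rcases h2 with h2 | h2
    · exact Finset.singleton_injective h2
    · have := congrArg Finset.card h2
      rw [Finset.card_compl] at this
      simp at this
      omega
  have := Finset.card_filter_add_card_filter_not (s := G.edgeFinset)
    (fun e => ∀ v ∈ e, v ∉ Set.range leaf)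
  rw [hp, hc] at this
  unfold internalEdgesG
  omega

lemma erase_aux {α : Type*} [DecidableEq α] {S T : Finset α} (hc : S.card = T.card)
    (h2 : (S ∆ T).card = 2) : ∃ τ σ, τ ∉ T ∧ σ ∈ T ∧ σ ∉ S ∧ S = insert τ (T.erase σ) := by
  have h3 : (S ∆ T).card = (S \ T).card + (T \ S).card := by
    rw [symmDiff_def, Finset.sup_eq_union, Finset.card_union_of_disjoint disjoint_sdiff_sdiff]
  have h4 := Finset.card_sdiff_add_card_inter S T
  have h5 := Finset.card_sdiff_add_card_inter T S
  rw [Finset.inter_comm] at h5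
  obtain ⟨τ, hτ⟩ := Finset.card_eq_one.1 (show (S \ T).card = 1 by omega)
  obtain ⟨σ, hσ⟩ := Finset.card_eq_one.1 (show (T \ S).card = 1 by omega)
  have m1 : ∀ x, (x ∈ S ∧ x ∉ T) ↔ x = τ := by
    intro x; rw [← Finset.mem_sdiff, hτ, Finset.mem_singleton]
  have m2 : ∀ x, (x ∈ T ∧ x ∉ S) ↔ x = σ := by
    intro x; rw [← Finset.mem_sdiff, hσ, Finset.mem_singleton]
  refine ⟨τ, σ, ((m1 τ).2 rfl).2, ((m2 σ).2 rfl).1, ((m2 σ).2 rfl).2, ?_⟩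
  ext x
  rw [Finset.mem_insert, Finset.mem_erase]
  have := m1 x
  have := m2 x
  tauto

lemma even_aux {α : Type*} [DecidableEq α] {S T : Finset α} (hc : S.card = T.card)
    (h2 : (S ∆ T).card ≤ 2) (hne : S ≠ T) : (S ∆ T).card = 2 := by
  have h3 : (S ∆ T).card = (S \ T).card + (T \ S).card := by
    rw [symmDiff_def, Finset.sup_eq_union, Finset.card_union_of_disjoint disjoint_sdiff_sdiff]
  have h4 := Finset.card_sdiff_add_card_inter S T
  have h5 := Finset.card_sdiff_add_card_inter T S
  rw [Finset.inter_comm] at h5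
  have : (S ∆ T).card ≠ 0 := by
    rw [Ne, Finset.card_eq_zero, ← Finset.bot_eq_empty, symmDiff_eq_bot]
    exact hne
  omega

lemma insert_symm {α : Type*} [DecidableEq α] {T : Finset α} {τ σ : α} (hτ : τ ∉ T) (hσ : σ ∈ T) :
    (insert τ (T.erase σ) ∆ T).card = 2 := by
  have : insert τ (T.erase σ) ∆ T = {τ, σ} := by
    ext x
    rw [Finset.mem_symmDiff, Finset.mem_insert, Finset.mem_erase, Finset.mem_insert,
      Finset.mem_singleton]
    by_cases h1 : x = τ
    · subst h1; simp [hτ]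
    · by_cases h2 : x = σ
      · subst h2; simp [hσ, h1]
      · simp [h1, h2]
  rw [this, Finset.card_pair]
  rintro rfl
  exact hτ hσ

lemma insert_inj {α : Type*} [DecidableEq α] {T : Finset α} {τ τ' σ σ' : α} (hτ : τ ∉ T)
    (hτ' : τ' ∉ T) (hσ : σ ∈ T) (hσ' : σ' ∈ T)
    (h : insert τ (T.erase σ) = insert τ' (T.erase σ')) : τ = τ' ∧ σ = σ' := by
  constructor
  · have : τ ∈ insert τ' (T.erase σ') := h ▸ Finset.mem_insert_self _ _
    rw [Finset.mem_insert, Finset.mem_erase] at this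
    tauto
  · by_contra hne
    have : σ ∈ insert τ (T.erase σ) := by
      rw [h]
      exact Finset.mem_insert_of_mem (Finset.mem_erase.2 ⟨hne, hσ⟩)
    rw [Finset.mem_insert, Finset.mem_erase] at this
    rcases this with rfl | h
    · exact hτ hσ
    · exact h.1 rfl

lemma card_of_all {S : Finset (Sym2 (Finset (Fin n)))} (hT : IsBinaryPhylo n G leaf)
    (h : S ∈ allBPTSplits n) : S.card = (splitsOf n G leaf).card := by
  obtain ⟨G', hT', rfl⟩ := mem_all_iff h
  have := card_splits hT
  have := card_splits hT'
  have := card_E hT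
  have := card_E hT'
  omega

lemma count_D (hn : 4 ≤ n) (hT : IsBinaryPhylo n G leaf) :
    ((allBPTSplits n).filter (fun S => (S ∆ splitsOf n G leaf).card = 2)).card = 2 * (n - 3) := by
  have key : ∀ e : Sym2 V, ∃ P : Finset (Sym2 (Finset (Fin n))), e ∈ internalEdgesG n G leaf →
      P.card = 2 ∧ (∀ τ ∈ P, τ ∉ splitsOf n G leaf) ∧ ∀ τ, τ ∉ splitsOf n G leaf →
        (insert τ ((splitsOf n G leaf).erase (splitOfEdge n G leaf e)) ∈ allBPTSplits n ↔
          τ ∈ P) := by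
    intro e
    by_cases he : e ∈ internalEdgesG n G leaf
    · induction e with
      | _ u v =>
      have he' := he
      unfold internalEdgesG at he'
      rw [Finset.mem_filter, SimpleGraph.mem_edgeFinset] at he'
      obtain ⟨τ₁, τ₂, h1, h2, h3, h4⟩ := main_e hn hT he'.1 (he'.2 u (Sym2.mem_mk_left _ _))
        (he'.2 v (Sym2.mem_mk_right _ _))
      refine ⟨{τ₁, τ₂}, fun _ => ⟨Finset.card_pair h1, ?_, ?_⟩⟩
      · intro τ hτ
        rw [Finset.mem_insert, Finset.mem_singleton] at hτ
        rcases hτ with rfl | rfl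
        · exact h2
        · exact h3
      · intro τ hτ
        rw [h4 τ hτ, Finset.mem_insert, Finset.mem_singleton]
    · exact ⟨∅, fun h => absurd h he⟩
  choose P hP using key
  have hsp : ∀ e ∈ internalEdgesG n G leaf, e ∈ G.edgeSet ∧
      splitOfEdge n G leaf e ∈ splitsOf n G leaf := by
    intro e he
    unfold internalEdgesG at he
    have h1 := (Finset.mem_filter.1 he).1
    exact ⟨SimpleGraph.mem_edgeFinset.1 h1, Finset.mem_image_of_mem _ h1⟩
  have hD : (allBPTSplits n).filter (fun S => (S ∆ splitsOf n G leaf).card = 2) =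
      ((internalEdgesG n G leaf).sigma P).image
        (fun x => insert x.2 ((splitsOf n G leaf).erase (splitOfEdge n G leaf x.1))) := by
    ext S
    rw [Finset.mem_filter, Finset.mem_image]
    constructor
    · rintro ⟨hS, h2⟩
      obtain ⟨τ, σ, hτ, hσ, hσS, rfl⟩ := erase_aux (card_of_all hT hS) h2
      have hσ' := hσ
      unfold splitsOf at hσ'
      obtain ⟨e, he, rfl⟩ := Finset.mem_image.1 hσ'
      have hi : e ∈ internalEdgesG n G leaf := by
        unfold internalEdgesG
        refine Finset.mem_filter.2 ⟨he, ?_⟩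
        rintro w hw ⟨i, rfl⟩
        apply hσS
        have : splitOfEdge n G leaf e = s({i}, {i}ᶜ) := by
          obtain ⟨x, rfl⟩ := Sym2.mem_iff_exists.1 hw
          have hx : G.Adj x (leaf i) := (SimpleGraph.mem_edgeFinset.1 he).symm
          rw [Sym2.eq_swap, split_eq' hT hx, L_leaf hT hx]
        rw [this] at hS ⊢
        obtain ⟨G', hT', hG'⟩ := mem_all_iff hS
        rw [← hG']
        exact triv_mem hT' i
      refine ⟨⟨e, τ⟩, Finset.mem_sigma.2 ⟨hi, ?_⟩, rfl⟩
      exact ((hP e hi).2.2 τ hτ).1 hS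
    · rintro ⟨⟨e, τ⟩, hx, rfl⟩
      obtain ⟨h1, h2⟩ := Finset.mem_sigma.1 hx
      have hτ := (hP e h1).2.1 τ h2
      exact ⟨((hP e h1).2.2 τ hτ).2 h2, insert_symm hτ (hsp e h1).2⟩
  rw [hD, Finset.card_image_of_injOn, Finset.card_sigma,
    Finset.sum_congr rfl (fun e he => (hP e he).1), Finset.sum_const, card_internal hn hT,
    smul_eq_mul, mul_comm]
  rintro ⟨e, τ⟩ hx ⟨e', τ'⟩ hx' h
  rw [Finset.mem_coe] at hx hx'
  obtain ⟨h1, h2⟩ := Finset.mem_sigma.1 hx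
  obtain ⟨h1', h2'⟩ := Finset.mem_sigma.1 hx'
  obtain ⟨q1, q2⟩ := insert_inj ((hP e h1).2.1 τ h2) ((hP e' h1').2.1 τ' h2') (hsp e h1).2
    (hsp e' h1').2 h
  have := split_inj hT (hsp e h1).1 (hsp e' h1').1 q2
  subst q1 this
  rfl

lemma count_le (hn : 4 ≤ n) (hT : IsBinaryPhylo n G leaf) :
    ((allBPTSplits n).filter (fun S => (S ∆ splitsOf n G leaf).card ≤ 2)).card
      = 2 * (n - 3) + 1 := by
  have : (allBPTSplits n).filter (fun S => (S ∆ splitsOf n G leaf).card ≤ 2) =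
      insert (splitsOf n G leaf)
        ((allBPTSplits n).filter (fun S => (S ∆ splitsOf n G leaf).card = 2)) := by
    ext S
    rw [Finset.mem_insert, Finset.mem_filter, Finset.mem_filter]
    constructor
    · rintro ⟨h1, h2⟩
      by_cases h : S = splitsOf n G leaf
      · exact Or.inl h
      · exact Or.inr ⟨h1, even_aux (card_of_all hT h1) h2 h⟩
    · rintro (rfl | ⟨h1, h2⟩)
      · refine ⟨mem_all hn hT, ?_⟩
        rw [symmDiff_self]; simp
      · exact ⟨h1, h2.le⟩
  rw [this, Finset.card_insert_of_notMem, count_D hn hT]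
  rw [Finset.mem_filter, symmDiff_self]
  simp

end final

end RF

/-- For `n ≥ 4` and `T ∈ BPT(n)`, exactly `2(n-3)` trees
`T' ∈ BPT(n)` have Robinson–Foulds distance `d(T,T') = 2` from `T`; equivalently,
`N₂(T) = 2(n-3) + 1` trees (including `T` itself) are within distance `2` of `T`.
(Trees in `BPT(n)` are counted via their split systems, which determine them up to
isomorphism fixing the leaf labels.) -/
theorem count_trees_at_rf_distance_two {n : ℕ} (hn : 4 ≤ n)
    {V : Type} [Fintype V] (G : SimpleGraph V) (leaf : Fin n → V)
    (hT : IsBinaryPhylo n G leaf) :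
    ((allBPTSplits n).filter
        (fun S => (S ∆ splitsOf n G leaf).card = 2)).card = 2 * (n - 3) ∧
      ((allBPTSplits n).filter
        (fun S => (S ∆ splitsOf n G leaf).card ≤ 2)).card = 2 * (n - 3) + 1 := by
  exact ⟨RF.count_D hn hT, RF.count_le hn hT⟩
end
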